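/- arXiv:2209.07012 — 3 statements merged into one kernel-verified Lean document; each statement's English description precedes it below -/
import Mathlib

section
/- (Lemma 3.1, first part: inductive step for the Lyapunov exponents) Fix ε > 0 small, let ω ∈ Ω_ε, let α : 𝕋² → 𝔻 be real-analytic, λ ∈ (0,1) and z ∈ ∂𝔻. Let γ > 0 be sufficiently small and suppose positive integers n < N satisfy: (i) mes[(x,y) ∈ 𝕋² : |(1/n)·log‖M_n^z(x,y)‖ − L_n(z)| > (γ/10)·P(z)] ≤ N^{−10}; (ii) mes[(x,y) ∈ 𝕋² : |(1/(2n))·log‖M_{2n}^z(x,y)‖ − L_{2n}(z)| > (γ/10)·P(z)] ≤ N^{−10}; (iii) min(L_n(z), L_{2n}(z)) ≥ γ·P(z); (iv) L_n(z) − L_{2n}(z) ≤ (γ/40)·P(z); (v) 9γ·n·P(z) ≥ 10·log(2N) and n² ≤ N. Then there is an absolute constant C₀ such that L_N(z) ≥ γ·P(z) − 2·(L_n(z) − L_{2n}(z)) − C₀·n·N^{−1}·P(z) and L_N(z) − L_{2N}(z) ≤ C₀·n·N^{−1}·P(z). -/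
open MeasureTheory Complex Filter Matrix

noncomputable section

/-- The circle `𝕋 = ℝ/ℤ`. -/
abbrev Torus : Type := AddCircle (1 : ℝ)

/-- The two-torus `𝕋² = (ℝ/ℤ)²`. -/
abbrev Torus2 : Type := Torus × Torus

/-- The skew-shift `T_ω(x,y) = (x+y, y+ω)`. -/
def skewShift (ω : Torus) (p : Torus2) : Torus2 := (p.1 + p.2, p.2 + ω)

/-- The `n`-th iterate (`n ∈ ℤ`) of the skew-shift:
`T_ω^n(x,y) = (x + n·y + (n(n−1)/2)·ω, y + n·ω)`. -/
def skewIter (ω : Torus) (n : ℤ) (p : Torus2) : Torus2 :=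
  (p.1 + n • p.2 + (n * (n - 1) / 2) • ω, p.2 + n • ω)

/-- The set `Ω_ε` of Diophantine frequencies:
`‖nω‖ ≥ ε · n⁻¹ · (1 + log n)⁻²` for every positive integer `n`. -/
def DiophSet (ε : ℝ) : Set Torus :=
  {ω | ∀ n : ℕ, 0 < n → ε * (n : ℝ)⁻¹ * ((1 + Real.log n) ^ 2)⁻¹ ≤ ‖(n : ℤ) • ω‖}

/-- A trigonometric polynomial on `𝕋²`: a finite linear combination of the characters
`e^{2πi(mx+ky)}`, `(m,k) ∈ ℤ²`. -/
def IsTrigPoly (α : Torus2 → ℂ) : Prop :=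
  ∃ (F : Finset (ℤ × ℤ)) (c : ℤ × ℤ → ℂ), ∀ p : Torus2,
    α p = ∑ mk ∈ F, c mk * (AddCircle.toCircle (mk.1 • p.1) : ℂ) *
      (AddCircle.toCircle (mk.2 • p.2) : ℂ)

/-- `α : 𝕋² → ℂ` is real-analytic: its lift to `ℝ²` is real-analytic. -/
def IsRealAnalyticT2 (α : Torus2 → ℂ) : Prop :=
  ∃ f : ℝ × ℝ → ℂ, (∀ q : ℝ × ℝ, AnalyticAt ℝ f q) ∧
    ∀ x y : ℝ, f (x, y) = α ((x : Torus), (y : Torus))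

/-- The operator norm (w.r.t. the Euclidean norm) of a finite square complex matrix. -/
def matOpNorm {n : Type*} [Fintype n] [DecidableEq n] (A : Matrix n n ℂ) : ℝ :=
  ‖Matrix.toEuclideanCLM (𝕜 := ℂ) A‖

/-- The Szegő cocycle matrix `M^z(x,y)`, where `sz` is a fixed square root of `z` and the
Verblunsky coefficient is `α₀(x,y) = λ·α(x,y)`, `ρ₀ = (1−|α₀|²)^{1/2}`. -/
def szegoCocycle (α : Torus2 → ℂ) (lam : ℝ) (sz : ℂ) (p : Torus2) :
    Matrix (Fin 2) (Fin 2) ℂ :=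
  ((Real.sqrt (1 - ‖(lam : ℂ) * α p‖ ^ 2) : ℂ))⁻¹ •
    !![sz, -(starRingEnd ℂ) ((lam : ℂ) * α p) / sz;
       -((lam : ℂ) * α p) * sz, 1 / sz]

/-- The `n`-step transfer matrix `M_n^z(x,y) = M^z(T_ω^{n−1}(x,y)) ⋯ M^z(T_ω(x,y))·M^z(x,y)`. -/
def transfer (α : Torus2 → ℂ) (lam : ℝ) (ω : Torus) (sz : ℂ) :
    ℕ → Torus2 → Matrix (Fin 2) (Fin 2) ℂ
  | 0, _ => 1
  | n + 1, p => szegoCocycle α lam sz ((skewShift ω)^[n] p) * transfer α lam ω sz n p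

/-- The finite-scale Lyapunov exponent `L_n(z) = (1/n)∫_{𝕋²} log‖M_n^z(x,y)‖ dx dy`. -/
def LyapFin (α : Torus2 → ℂ) (lam : ℝ) (ω : Torus) (sz : ℂ) (n : ℕ) : ℝ :=
  (n : ℝ)⁻¹ * ∫ p : Torus2, Real.log (matOpNorm (transfer α lam ω sz n p))

/-- The scaling factor `P(z) = log((1−λ²·(sup|α|)²)^{−1/2} + C_α + (1−λ²)^{−1} + |z|)`. -/
def Pscale (α : Torus2 → ℂ) (lam : ℝ) (Cα : ℝ) (z : ℂ) : ℝ :=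
  Real.log ((Real.sqrt (1 - lam ^ 2 * (⨆ p : Torus2, ‖α p‖) ^ 2))⁻¹ + Cα +
    (1 - lam ^ 2)⁻¹ + ‖z‖)

/-- The symplectic form `p ∧ q` on `ℂ²`. -/
def wedge (p q : EuclideanSpace ℂ (Fin 2)) : ℂ := p 0 * q 1 - p 1 * q 0

/-- The conjugate-linear quarter turn of `ℂ²`. -/
def quarterTurn (q : EuclideanSpace ℂ (Fin 2)) : EuclideanSpace ℂ (Fin 2) :=
  !₂[(starRingEnd ℂ) (q 1), -(starRingEnd ℂ) (q 0)]

lemma norm_quarterTurn (q : EuclideanSpace ℂ (Fin 2)) : ‖quarterTurn q‖ = ‖q‖ := by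
  simp [EuclideanSpace.norm_eq, quarterTurn, add_comm]

lemma wedge_decomposition (p q : EuclideanSpace ℂ (Fin 2)) :
    ((‖q‖ ^ 2 : ℝ) : ℂ) • p = inner ℂ q p • q + wedge p q • quarterTurn q := by
  have hq : ((‖q‖ ^ 2 : ℝ) : ℂ)
      = q 0 * (starRingEnd ℂ) (q 0) + q 1 * (starRingEnd ℂ) (q 1) := by
    rw [EuclideanSpace.norm_sq_eq]
    simp [Fin.sum_univ_two, Complex.mul_conj, Complex.normSq_eq_norm_sq]
  have hi : inner ℂ q p = (starRingEnd ℂ) (q 0) * p 0 + (starRingEnd ℂ) (q 1) * p 1 := by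
    simp [PiLp.inner_apply, Fin.sum_univ_two, mul_comm]
  rw [hq, hi]
  ext i
  fin_cases i <;> simp [wedge, quarterTurn] <;> ring

lemma norm_wedge_le (p q : EuclideanSpace ℂ (Fin 2)) : ‖wedge p q‖ ≤ ‖p‖ * ‖q‖ := by
  have h : wedge p q = inner ℂ (quarterTurn q) p := by
    simp [PiLp.inner_apply, Fin.sum_univ_two, quarterTurn, wedge]
    ring
  rw [h]
  calc _ ≤ ‖quarterTurn q‖ * ‖p‖ := norm_inner_le_norm _ _
    _ = ‖p‖ * ‖q‖ := by rw [norm_quarterTurn, mul_comm]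

lemma wedge_toEuclideanCLM (A : Matrix (Fin 2) (Fin 2) ℂ) (p q : EuclideanSpace ℂ (Fin 2)) :
    wedge (Matrix.toEuclideanCLM (𝕜 := ℂ) A p) (Matrix.toEuclideanCLM (𝕜 := ℂ) A q) =
      A.det * wedge p q := by
  simp only [wedge, Matrix.ofLp_toEuclideanCLM, Matrix.mulVec, dotProduct, Fin.sum_univ_two,
    Matrix.det_fin_two]
  ring

lemma norm_map_mul_norm_le (X : EuclideanSpace ℂ (Fin 2) →L[ℂ] EuclideanSpace ℂ (Fin 2))
    (p q : EuclideanSpace ℂ (Fin 2)) :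
    ‖X p‖ * ‖q‖ ≤ ‖X q‖ * ‖p‖ + ‖wedge p q‖ * ‖X‖ := by
  rcases (norm_nonneg q).eq_or_lt with hq | hq
  · rw [← hq]
    simpa using by positivity
  have h := congrArg (fun v => ‖X v‖) (wedge_decomposition p q)
  simp only [map_smul, map_add, norm_smul, Complex.norm_real, norm_pow, norm_norm] at h
  have h1 : ‖inner ℂ q p • X q + wedge p q • X (quarterTurn q)‖ ≤
      ‖q‖ * ‖p‖ * ‖X q‖ + ‖wedge p q‖ * (‖X‖ * ‖q‖) := by
    refine (norm_add_le _ _).trans ?_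
    rw [norm_smul, norm_smul]
    gcongr
    · exact norm_inner_le_norm _ _
    · exact (X.le_opNorm _).trans_eq (by rw [norm_quarterTurn])
  rw [← h] at h1
  nlinarith

lemma opNorm_mul_opNorm_le {E F : Type*} [NormedAddCommGroup E] [NormedSpace ℂ E]
    [NormedAddCommGroup F] [NormedSpace ℂ F] (A B : E →L[ℂ] F) {C : ℝ} (hC : 0 ≤ C)
    (h : ∀ v w, ‖A v‖ * ‖B w‖ ≤ C * ‖v‖ * ‖w‖) : ‖A‖ * ‖B‖ ≤ C := by
  have h1 : ∀ v, ‖A v‖ * ‖B‖ ≤ C * ‖v‖ := fun v => by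
    have := ContinuousLinearMap.opNorm_le_bound (((‖A v‖ : ℝ) : ℂ) • B)
      (M := C * ‖v‖) (by positivity) (fun w => by simpa [norm_smul] using h v w)
    simpa [norm_smul] using this
  have := ContinuousLinearMap.opNorm_le_bound (((‖B‖ : ℝ) : ℂ) • A)
      (M := C) hC (fun w => by simpa [norm_smul, mul_comm] using h1 w)
  simpa [norm_smul, mul_comm] using this

lemma matOpNorm_nonneg (A : Matrix (Fin 2) (Fin 2) ℂ) : 0 ≤ matOpNorm A := norm_nonneg _

lemma matOpNorm_one : matOpNorm (1 : Matrix (Fin 2) (Fin 2) ℂ) = 1 := by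
  simp [matOpNorm]

lemma matOpNorm_mul_le (A B : Matrix (Fin 2) (Fin 2) ℂ) :
    matOpNorm (A * B) ≤ matOpNorm A * matOpNorm B := by
  simpa [matOpNorm] using norm_mul_le (Matrix.toEuclideanCLM (𝕜 := ℂ) A) _

/-- The two inequalities expressing that `‖XYZ‖‖Y‖` and `‖XY‖‖YZ‖` agree up to `‖X‖‖Z‖` when
`Y` is unimodular. -/
lemma matOpNorm_triple (X Y Z : Matrix (Fin 2) (Fin 2) ℂ) (hY : Y.det = 1) :
    matOpNorm (X * Y * Z) * matOpNorm Y ≤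
        matOpNorm (X * Y) * matOpNorm (Y * Z) + matOpNorm X * matOpNorm Z ∧
      matOpNorm (X * Y) * matOpNorm (Y * Z) ≤
        matOpNorm (X * Y * Z) * matOpNorm Y + matOpNorm X * matOpNorm Z := by
  have hw : ∀ v w, ‖wedge (Matrix.toEuclideanCLM (𝕜 := ℂ) Y (Matrix.toEuclideanCLM (𝕜 := ℂ) Z v))
      (Matrix.toEuclideanCLM (𝕜 := ℂ) Y w)‖ ≤
        ‖Matrix.toEuclideanCLM (𝕜 := ℂ) Z‖ * ‖v‖ * ‖w‖ := fun v w => by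
    rw [wedge_toEuclideanCLM, hY, one_mul]
    refine (norm_wedge_le _ _).trans ?_
    gcongr
    exact ContinuousLinearMap.le_opNorm _ _
  have hswap : ∀ p q, ‖wedge q p‖ = ‖wedge p q‖ := fun p q => by
    rw [← norm_neg]
    simp only [wedge]
    ring_nf
  unfold matOpNorm
  refine ⟨opNorm_mul_opNorm_le _ _ (by positivity) fun v w => ?_,
    opNorm_mul_opNorm_le _ _ (by positivity) fun w v => ?_⟩
  · have h := norm_map_mul_norm_le (Matrix.toEuclideanCLM (𝕜 := ℂ) X)
      (Matrix.toEuclideanCLM (𝕜 := ℂ) (Y * Z) v) (Matrix.toEuclideanCLM (𝕜 := ℂ) Y w)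
    have h1 := ContinuousLinearMap.le_opNorm (Matrix.toEuclideanCLM (𝕜 := ℂ) (X * Y)) w
    have h2 := ContinuousLinearMap.le_opNorm (Matrix.toEuclideanCLM (𝕜 := ℂ) (Y * Z)) v
    have h3 := mul_le_mul h1 h2 (norm_nonneg _) (by positivity)
    have h4 := mul_le_mul_of_nonneg_right (hw v w)
      (norm_nonneg (Matrix.toEuclideanCLM (𝕜 := ℂ) X))
    simp only [map_mul, mul_apply_eq_comp] at *
    linarith
  · have h := norm_map_mul_norm_le (Matrix.toEuclideanCLM (𝕜 := ℂ) X)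
      (Matrix.toEuclideanCLM (𝕜 := ℂ) Y w) (Matrix.toEuclideanCLM (𝕜 := ℂ) (Y * Z) v)
    have h1 := ContinuousLinearMap.le_opNorm (Matrix.toEuclideanCLM (𝕜 := ℂ) (X * Y * Z)) v
    have h2 := ContinuousLinearMap.le_opNorm (Matrix.toEuclideanCLM (𝕜 := ℂ) Y) w
    have h3 := mul_le_mul h1 h2 (norm_nonneg _) (by positivity)
    rw [hswap] at h
    have h4 := mul_le_mul_of_nonneg_right (hw v w)
      (norm_nonneg (Matrix.toEuclideanCLM (𝕜 := ℂ) X))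
    simp only [map_mul, mul_apply_eq_comp] at *
    linarith

lemma norm_le_matOpNorm_mul (A : Matrix (Fin 2) (Fin 2) ℂ) (hA : A.det = 1)
    (p : EuclideanSpace ℂ (Fin 2)) :
    ‖p‖ ≤ matOpNorm A * ‖Matrix.toEuclideanCLM (𝕜 := ℂ) A p‖ := by
  rcases (norm_nonneg p).eq_or_lt with hp | hp
  · rw [← hp]
    exact mul_nonneg (matOpNorm_nonneg _) (norm_nonneg _)
  have h1 := wedge_toEuclideanCLM A p (quarterTurn p)
  have h2 : ‖wedge p (quarterTurn p)‖ = ‖p‖ ^ 2 := by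
    have : wedge p (quarterTurn p) = -inner ℂ p p := by
      simp only [wedge, quarterTurn, PiLp.inner_apply, Fin.sum_univ_two, RCLike.inner_apply]
      simp
      ring
    rw [this, norm_neg, inner_self_eq_norm_sq_to_K]
    simp
  have h3 := norm_wedge_le (Matrix.toEuclideanCLM (𝕜 := ℂ) A p)
    (Matrix.toEuclideanCLM (𝕜 := ℂ) A (quarterTurn p))
  rw [h1, hA, one_mul, h2] at h3
  have h4 := ContinuousLinearMap.le_opNorm (Matrix.toEuclideanCLM (𝕜 := ℂ) A) (quarterTurn p)
  rw [norm_quarterTurn] at h4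
  have h5 := mul_le_mul_of_nonneg_left h4 (norm_nonneg (Matrix.toEuclideanCLM (𝕜 := ℂ) A p))
  unfold matOpNorm
  nlinarith

lemma matOpNorm_le_mul_matOpNorm_mul (A B : Matrix (Fin 2) (Fin 2) ℂ) (hA : A.det = 1) :
    matOpNorm B ≤ matOpNorm A * matOpNorm (A * B) := by
  refine ContinuousLinearMap.opNorm_le_bound _
    (mul_nonneg (matOpNorm_nonneg _) (matOpNorm_nonneg _)) fun v => ?_
  refine (norm_le_matOpNorm_mul A hA _).trans ?_
  rw [mul_assoc]
  refine mul_le_mul_of_nonneg_left ?_ (matOpNorm_nonneg _)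
  simpa [matOpNorm] using
    ContinuousLinearMap.le_opNorm (Matrix.toEuclideanCLM (𝕜 := ℂ) (A * B)) v

lemma one_le_matOpNorm (A : Matrix (Fin 2) (Fin 2) ℂ) (hA : A.det = 1) : 1 ≤ matOpNorm A := by
  have h := matOpNorm_le_mul_matOpNorm_mul A 1 hA
  rw [matOpNorm_one, mul_one] at h
  nlinarith [matOpNorm_nonneg A]

lemma continuous_matOpNorm :
    Continuous (matOpNorm : Matrix (Fin 2) (Fin 2) ℂ → ℝ) := by
  have h : Continuous fun A : Matrix (Fin 2) (Fin 2) ℂ => Matrix.toEuclideanCLM (𝕜 := ℂ) A :=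
    LinearMap.continuous_of_finiteDimensional
      ((Matrix.toEuclideanCLM (n := Fin 2) (𝕜 := ℂ)).toAlgEquiv.toLinearMap)
  exact h.norm

/-- One step of the avalanche principle: three unimodular factors with controlled cancellation
between neighbours. -/
lemma avalanche_step (X Y Z : Matrix (Fin 2) (Fin 2) ℂ) (hX : X.det = 1) (hY : Y.det = 1)
    (hZ : Z.det = 1) {l : ℝ} (hl : 4 ≤ Real.exp l) (hYl : l ≤ Real.log (matOpNorm Y))
    (hXY : Real.log (matOpNorm X) + Real.log (matOpNorm Y) - Real.log (matOpNorm (X * Y)) ≤ l / 2)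
    (hYZ : Real.log (matOpNorm Y) + Real.log (matOpNorm Z) - Real.log (matOpNorm (Y * Z)) ≤
      l / 2 + Real.log 2) :
    |Real.log (matOpNorm (X * Y * Z)) + Real.log (matOpNorm Y) - Real.log (matOpNorm (X * Y)) -
        Real.log (matOpNorm (Y * Z))| ≤ 4 * Real.exp (-l) ∧
      Real.log (matOpNorm X) + Real.log (matOpNorm (Y * Z)) - Real.log (matOpNorm (X * Y * Z)) ≤
        l / 2 + Real.log 2 := by
  obtain ⟨h1, h2⟩ := matOpNorm_triple X Y Z hY
  have pos : ∀ A : Matrix (Fin 2) (Fin 2) ℂ, A.det = 1 → 0 < matOpNorm A := fun A hA =>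
    one_pos.trans_le (one_le_matOpNorm A hA)
  have x0 := pos X hX
  have y0 := pos Y hY
  have z0 := pos Z hZ
  have xy0 := pos (X * Y) (by rw [Matrix.det_mul, hX, hY, one_mul])
  have yz0 := pos (Y * Z) (by rw [Matrix.det_mul, hY, hZ, one_mul])
  have xyz0 := pos (X * Y * Z) (by rw [Matrix.det_mul, Matrix.det_mul, hX, hY, hZ]; norm_num)
  generalize matOpNorm (X * Y * Z) = xyz at *
  generalize matOpNorm (X * Y) = xy at *
  generalize matOpNorm (Y * Z) = yz at *
  generalize matOpNorm X = x at *
  generalize matOpNorm Y = y at *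
  generalize matOpNorm Z = z at *
  set d := 2 * Real.exp (-l) with hd
  have hd0 : 0 < d := by positivity
  have hd1 : d ≤ 1 / 2 := by
    rw [hd, Real.exp_neg, ← div_eq_mul_inv, div_le_div_iff₀ (by positivity) (by norm_num)]
    linarith
  have hxz : x * z ≤ d * (xy * yz) := by
    rw [← Real.log_le_log_iff (by positivity) (by positivity), Real.log_mul x0.ne' z0.ne',
      Real.log_mul hd0.ne' (by positivity), Real.log_mul xy0.ne' yz0.ne', hd,
      Real.log_mul (by norm_num) (by positivity), Real.log_exp]
    linarith
  have hup : Real.log (xyz * y) ≤ Real.log (xy * yz) + d := by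
    have h : xyz * y ≤ xy * yz * (1 + d) := by nlinarith
    have h3 := Real.log_le_log (by positivity) h
    rw [Real.log_mul (x := xy * yz) (by positivity) (by positivity)] at h3
    have h4 := Real.log_le_sub_one_of_pos (show 0 < 1 + d by positivity)
    linarith
  have hlow' : xy * yz * (1 - d) ≤ xyz * y := by nlinarith
  have hd2 : 0 < 1 - d := by linarith
  have h3 := Real.log_le_log (by positivity) hlow'
  rw [Real.log_mul (x := xy * yz) (by positivity) hd2.ne'] at h3
  have hlow : Real.log (xy * yz) - 2 * d ≤ Real.log (xyz * y) := by
    have h5 : (1 - d)⁻¹ - 1 ≤ 2 * d := by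
      rw [sub_le_iff_le_add, inv_le_iff_one_le_mul₀ hd2]
      nlinarith
    have h6 := Real.one_sub_inv_le_log_of_pos hd2
    linarith
  have h7 : -Real.log 2 ≤ Real.log (1 - d) := by
    rw [← Real.log_inv]
    exact Real.log_le_log (by norm_num) (by linarith)
  rw [Real.log_mul xyz0.ne' y0.ne', Real.log_mul xy0.ne' yz0.ne'] at *
  refine ⟨?_, by linarith⟩
  rw [abs_le]
  constructor <;> linarith

/-- Avalanche principle for a product `B k = A (k - 1) ⋯ A 0` of unimodular matrices, in
incremental form. -/
lemma avalanche_principle (A B : ℕ → Matrix (Fin 2) (Fin 2) ℂ) (hA : ∀ j, (A j).det = 1)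
    (hB : ∀ j, (B j).det = 1) (hB0 : B 0 = 1) (hBs : ∀ j, B (j + 1) = A j * B j)
    {l : ℝ} (hl : 4 ≤ Real.exp l) (k : ℕ) (h1 : ∀ j ≤ k, l ≤ Real.log (matOpNorm (A j)))
    (h2 : ∀ j ≤ k, Real.log (matOpNorm (A j)) + Real.log (matOpNorm (A (j + 1))) -
      Real.log (matOpNorm (A (j + 1) * A j)) ≤ l / 2) :
    |Real.log (matOpNorm (B (k + 2))) + Real.log (matOpNorm (A k)) -
        Real.log (matOpNorm (A (k + 1) * A k)) - Real.log (matOpNorm (B (k + 1)))| ≤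
      4 * Real.exp (-l) := by
  have key : ∀ j ≤ k, Real.log (matOpNorm (A j)) + Real.log (matOpNorm (B j)) -
      Real.log (matOpNorm (A j * B j)) ≤ l / 2 + Real.log 2 →
      |Real.log (matOpNorm (B (j + 2))) + Real.log (matOpNorm (A j)) -
        Real.log (matOpNorm (A (j + 1) * A j)) - Real.log (matOpNorm (B (j + 1)))| ≤
        4 * Real.exp (-l) ∧
      Real.log (matOpNorm (A (j + 1))) + Real.log (matOpNorm (B (j + 1))) -
        Real.log (matOpNorm (A (j + 1) * B (j + 1))) ≤ l / 2 + Real.log 2 := by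
    intro j hj h
    have := avalanche_step (A (j + 1)) (A j) (B j) (hA _) (hA _) (hB _) hl (h1 j hj)
      (by linarith [h2 j hj]) h
    rwa [hBs (j + 1), hBs j, ← mul_assoc]
  have ang : ∀ j ≤ k, Real.log (matOpNorm (A j)) + Real.log (matOpNorm (B j)) -
      Real.log (matOpNorm (A j * B j)) ≤ l / 2 + Real.log 2 := by
    intro j
    induction j with
    | zero =>
      intro _
      have hl0 : 0 ≤ l := by
        by_contra! h
        linarith [Real.exp_le_one_iff.2 h.le]
      have := Real.log_nonneg (show (1 : ℝ) ≤ 2 by norm_num)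
      rw [hB0, mul_one, matOpNorm_one, Real.log_one]
      linarith
    | succ j ih => exact fun hj => (key j (by omega) (ih (by omega))).2
  exact (key k le_rfl (ang k le_rfl)).1

section Dynamics

variable {α : Torus2 → ℂ} {lam : ℝ} {ω : Torus} {sz : ℂ}

lemma transfer_add (a b : ℕ) (p : Torus2) :
    transfer α lam ω sz (a + b) p =
      transfer α lam ω sz a ((skewShift ω)^[b] p) * transfer α lam ω sz b p := by
  induction a with
  | zero => simp [transfer]
  | succ a ih =>
    rw [Nat.add_right_comm, transfer, ih, transfer, mul_assoc, Function.iterate_add_apply]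

lemma one_sub_normSq_pos (hα : ∀ p, ‖α p‖ < 1) (hlam : 0 < lam) (hlam1 : lam < 1) (p : Torus2) :
    0 < 1 - ‖(lam : ℂ) * α p‖ ^ 2 := by
  have h : ‖(lam : ℂ) * α p‖ < 1 := by
    rw [norm_mul, Complex.norm_real, Real.norm_of_nonneg hlam.le]
    nlinarith [hα p, norm_nonneg (α p)]
  nlinarith [norm_nonneg ((lam : ℂ) * α p)]

lemma det_szegoCocycle (hα : ∀ p, ‖α p‖ < 1) (hlam : 0 < lam) (hlam1 : lam < 1) (hsz : sz ≠ 0)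
    (p : Torus2) : (szegoCocycle α lam sz p).det = 1 := by
  have h := one_sub_normSq_pos hα hlam hlam1 p
  have hs : ((Real.sqrt (1 - ‖(lam : ℂ) * α p‖ ^ 2) : ℂ)) ^ 2 =
      1 - (lam : ℂ) * α p * (starRingEnd ℂ) ((lam : ℂ) * α p) := by
    rw [Complex.mul_conj, Complex.normSq_eq_norm_sq, ← Complex.ofReal_pow, Real.sq_sqrt h.le]
    push_cast
    ring
  have hs0 : ((Real.sqrt (1 - ‖(lam : ℂ) * α p‖ ^ 2) : ℂ)) ≠ 0 := by
    exact_mod_cast (Real.sqrt_pos.2 h).ne'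
  rw [szegoCocycle, Matrix.det_smul, Matrix.det_fin_two]
  simp only [Fintype.card_fin, Matrix.of_apply, Matrix.cons_val', Matrix.cons_val_zero,
    Matrix.cons_val_one, Matrix.cons_val_fin_one, inv_pow]
  rw [inv_mul_eq_iff_eq_mul₀ (pow_ne_zero 2 hs0), hs]
  field_simp

lemma det_transfer (hdet : ∀ p, (szegoCocycle α lam sz p).det = 1) (n : ℕ) (p : Torus2) :
    (transfer α lam ω sz n p).det = 1 := by
  induction n with
  | zero => simp [transfer]
  | succ n ih => rw [transfer, Matrix.det_mul, hdet, ih, one_mul]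

lemma log_matOpNorm_transfer_nonneg (hdet : ∀ p, (szegoCocycle α lam sz p).det = 1) (n : ℕ)
    (p : Torus2) : 0 ≤ Real.log (matOpNorm (transfer α lam ω sz n p)) :=
  Real.log_nonneg (one_le_matOpNorm _ (det_transfer hdet n p))

lemma abs_log_matOpNorm_transfer_add_sub_le (hdet : ∀ p, (szegoCocycle α lam sz p).det = 1)
    (a b : ℕ) (p : Torus2) :
    |Real.log (matOpNorm (transfer α lam ω sz (a + b) p)) -
      Real.log (matOpNorm (transfer α lam ω sz b p))| ≤
      Real.log (matOpNorm (transfer α lam ω sz a ((skewShift ω)^[b] p))) := by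
  have hA := det_transfer (ω := ω) hdet a ((skewShift ω)^[b] p)
  have hB := det_transfer (ω := ω) hdet b p
  rw [transfer_add]
  generalize transfer α lam ω sz a ((skewShift ω)^[b] p) = A at *
  generalize transfer α lam ω sz b p = B at *
  have a0 := one_pos.trans_le (one_le_matOpNorm A hA)
  have b0 := one_pos.trans_le (one_le_matOpNorm B hB)
  have ab0 := one_pos.trans_le (one_le_matOpNorm (A * B) (by rw [Matrix.det_mul, hA, hB, one_mul]))
  have h1 := Real.log_le_log ab0 (matOpNorm_mul_le A B)
  have h2 := Real.log_le_log b0 (matOpNorm_le_mul_matOpNorm_mul A B hA)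
  rw [Real.log_mul a0.ne' b0.ne'] at h1
  rw [Real.log_mul a0.ne' ab0.ne'] at h2
  rw [abs_le]
  constructor <;> linarith

lemma continuous_of_isRealAnalyticT2 (h : IsRealAnalyticT2 α) : Continuous α := by
  obtain ⟨f, hf, hfα⟩ := h
  have hq : IsOpenQuotientMap (Prod.map ((↑) : ℝ → Torus) ((↑) : ℝ → Torus)) :=
    QuotientAddGroup.isOpenQuotientMap_mk.prodMap QuotientAddGroup.isOpenQuotientMap_mk
  rw [← hq.continuous_comp_iff]
  have : α ∘ Prod.map ((↑) : ℝ → Torus) ((↑) : ℝ → Torus) = f := by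
    ext ⟨x, y⟩
    exact (hfα x y).symm
  rw [this]
  exact continuous_iff_continuousAt.2 fun q => (hf q).continuousAt

lemma continuous_skewShift : Continuous (skewShift ω) := by
  unfold skewShift
  fun_prop

lemma continuous_transfer (hα : Continuous α) (hα1 : ∀ p, ‖α p‖ < 1) (hlam : 0 < lam)
    (hlam1 : lam < 1) (n : ℕ) : Continuous (transfer α lam ω sz n) := by
  have hc : Continuous (szegoCocycle α lam sz) := by
    unfold szegoCocycle
    have hs : Continuous fun p => ((Real.sqrt (1 - ‖(lam : ℂ) * α p‖ ^ 2) : ℝ) : ℂ) := by fun_prop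
    refine Continuous.smul (hs.inv₀ fun p => ?_) ?_
    · exact_mod_cast (Real.sqrt_pos.2 (one_sub_normSq_pos hα1 hlam hlam1 p)).ne'
    · refine continuous_matrix fun i j => ?_
      have := Complex.continuous_conj
      fin_cases i <;> fin_cases j <;> simp <;> fun_prop
  induction n with
  | zero => exact continuous_const
  | succ n ih => exact (hc.comp (continuous_skewShift.iterate n)).matrix_mul ih

instance : IsProbabilityMeasure (volume : Measure Torus2) := by
  have : IsProbabilityMeasure (volume : Measure Torus) := ⟨by simp [AddCircle.measure_univ]⟩
  rw [Measure.volume_eq_prod]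
  infer_instance

lemma measurePreserving_skewShift : MeasurePreserving (skewShift ω) := by
  have h1 : MeasurePreserving (fun p : Torus2 => (p.1 + p.2, p.2)) :=
    measurePreserving_add_prod (volume : Measure Torus) volume
  have h2 : MeasurePreserving (Prod.map id (· + ω) : Torus2 → Torus2) :=
    (MeasurePreserving.id (volume : Measure Torus)).prod (measurePreserving_add_right volume ω)
  exact h2.comp h1

end Dynamics

lemma abs_integral_le_of_abs_le_off {Ω : Type*} [MeasurableSpace Ω] {μ : Measure Ω}
    [IsProbabilityMeasure μ] {g : Ω → ℝ} {c K d : ℝ} (s : Set Ω) (hc : 0 ≤ c) (hK : 0 ≤ K)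
    (hd : 0 ≤ d) (hg : ∀ p, |g p| ≤ K) (hgs : ∀ p ∉ s, |g p| ≤ c)
    (hs : μ s ≤ ENNReal.ofReal d) : |∫ p, g p ∂μ| ≤ c + K * d := by
  have hm := measurableSet_toMeasurable μ s
  have hint : Integrable (fun p => c + (toMeasurable μ s).indicator (fun _ => K) p) μ :=
    (integrable_const c).add ((integrable_const K).indicator hm)
  have h := norm_integral_le_of_norm_le (f := g) hint (Eventually.of_forall fun p => by
    by_cases hp : p ∈ toMeasurable μ s
    · simpa [hp] using (hg p).trans (by linarith)
    · simpa [hp] using hgs p fun h => hp (subset_toMeasurable μ s h))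
  rw [integral_add (integrable_const c) ((integrable_const K).indicator hm),
    integral_indicator_const _ hm] at h
  have hr : μ.real (toMeasurable μ s) ≤ d := by
    rw [Measure.real, measure_toMeasurable]
    exact ENNReal.toReal_le_of_le_ofReal hd hs
  simp only [integral_const, probReal_univ, smul_eq_mul, one_mul] at h
  rw [Real.norm_eq_abs] at h
  nlinarith

section LyapunovExponents

variable {α : Torus2 → ℂ} {lam : ℝ} {ω : Torus} {sz : ℂ}

lemma integrable_log_matOpNorm_transfer (hcont : ∀ n, Continuous (transfer α lam ω sz n))
    (hdet : ∀ p, (szegoCocycle α lam sz p).det = 1) (n : ℕ) :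
    Integrable fun p => Real.log (matOpNorm (transfer α lam ω sz n p)) := by
  have h : Continuous fun p => Real.log (matOpNorm (transfer α lam ω sz n p)) :=
    (continuous_matOpNorm.comp (hcont n)).log fun p =>
      (one_pos.trans_le (one_le_matOpNorm _ (det_transfer hdet n p))).ne'
  exact h.integrable_of_hasCompactSupport (HasCompactSupport.of_compactSpace _)

lemma integral_comp_iterate_skewShift (hcont : ∀ n, Continuous (transfer α lam ω sz n))
    (hdet : ∀ p, (szegoCocycle α lam sz p).det = 1) (n k : ℕ) :
    Integrable (fun p => Real.log (matOpNorm (transfer α lam ω sz n ((skewShift ω)^[k] p)))) ∧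
    ∫ p, Real.log (matOpNorm (transfer α lam ω sz n ((skewShift ω)^[k] p))) =
      ∫ p, Real.log (matOpNorm (transfer α lam ω sz n p)) := by
  have hT := (measurePreserving_skewShift (ω := ω)).iterate k
  have hi := integrable_log_matOpNorm_transfer hcont hdet n
  refine ⟨hT.integrable_comp_of_integrable hi, ?_⟩
  have h := integral_map (f := fun p => Real.log (matOpNorm (transfer α lam ω sz n p)))
    hT.measurable.aemeasurable (by rw [hT.map_eq]; exact hi.aestronglyMeasurable)
  rw [hT.map_eq] at h
  exact h.symm

/-- The integrated avalanche principle: consecutive increments of `∫ log ‖M_{kn}‖` are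
`∫ log ‖M_{2n}‖ - ∫ log ‖M_n‖` up to a small error. -/
lemma abs_integral_increment_le (hcont : ∀ n, Continuous (transfer α lam ω sz n))
    (hdet : ∀ p, (szegoCocycle α lam sz p).det = 1) {P : ℝ} (hP : 0 ≤ P)
    (hbd : ∀ m p, Real.log (matOpNorm (transfer α lam ω sz m p)) ≤ m * P)
    {l d : ℝ} (hl : 4 ≤ Real.exp l) (hd : 0 ≤ d) (n k : ℕ) (E : Set Torus2)
    (hE : volume E ≤ ENNReal.ofReal d)
    (hlow : ∀ p ∉ E, l ≤ Real.log (matOpNorm (transfer α lam ω sz n p)))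
    (hang : ∀ p ∉ E, (skewShift ω)^[n] p ∉ E →
      Real.log (matOpNorm (transfer α lam ω sz n p)) +
        Real.log (matOpNorm (transfer α lam ω sz n ((skewShift ω)^[n] p))) -
        Real.log (matOpNorm (transfer α lam ω sz (2 * n) p)) ≤ l / 2) :
    |(∫ p, Real.log (matOpNorm (transfer α lam ω sz ((k + 2) * n) p))) +
        (∫ p, Real.log (matOpNorm (transfer α lam ω sz n p))) -
        (∫ p, Real.log (matOpNorm (transfer α lam ω sz (2 * n) p))) -
        ∫ p, Real.log (matOpNorm (transfer α lam ω sz ((k + 1) * n) p))| ≤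
      4 * Real.exp (-l) + 4 * (n * P) * ((k + 2) * d) := by
  have I := integrable_log_matOpNorm_transfer hcont hdet
  obtain ⟨J1, e1⟩ := integral_comp_iterate_skewShift hcont hdet n (k * n)
  obtain ⟨J2, e2⟩ := integral_comp_iterate_skewShift hcont hdet (2 * n) (k * n)
  have J3 : Integrable fun p => Real.log (matOpNorm (transfer α lam ω sz ((k + 2) * n) p)) +
      Real.log (matOpNorm (transfer α lam ω sz n ((skewShift ω)^[k * n] p))) := (I _).add J1
  have J4 : Integrable fun p => Real.log (matOpNorm (transfer α lam ω sz ((k + 2) * n) p)) +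
      Real.log (matOpNorm (transfer α lam ω sz n ((skewShift ω)^[k * n] p))) -
      Real.log (matOpNorm (transfer α lam ω sz (2 * n) ((skewShift ω)^[k * n] p))) := J3.sub J2
  rw [← e1, ← e2, ← integral_add (I _) J1, ← integral_sub J3 J2, ← integral_sub J4 (I _)]
  refine abs_integral_le_of_abs_le_off
    (⋃ j ∈ Finset.range (k + 2), ((skewShift ω)^[j * n]) ⁻¹' E)
    (by positivity) (by positivity) (by positivity) (fun p => ?_) (fun p hp => ?_) ?_
  · have h1 := abs_le.1 (abs_log_matOpNorm_transfer_add_sub_le (ω := ω) hdet n ((k + 1) * n) p)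
    rw [show n + (k + 1) * n = (k + 2) * n by ring] at h1
    have h2 := hbd n ((skewShift ω)^[(k + 1) * n] p)
    have h3 := hbd n ((skewShift ω)^[k * n] p)
    have h4 := hbd (2 * n) ((skewShift ω)^[k * n] p)
    have h5 := log_matOpNorm_transfer_nonneg (ω := ω) hdet n ((skewShift ω)^[k * n] p)
    have h6 := log_matOpNorm_transfer_nonneg (ω := ω) hdet (2 * n) ((skewShift ω)^[k * n] p)
    push_cast at h4
    have h7 : 0 ≤ n * P := by positivity
    rw [abs_le]
    constructor <;> linarith
  · have hp' : ∀ j, j < k + 2 → (skewShift ω)^[j * n] p ∉ E := fun j hj h =>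
      hp (Set.mem_biUnion (Finset.mem_coe.2 (Finset.mem_range.2 hj)) h)
    have hit : ∀ j, (skewShift ω)^[(j + 1) * n] p =
        (skewShift ω)^[n] ((skewShift ω)^[j * n] p) := fun j => by
      rw [← Function.iterate_add_apply]
      ring_nf
    have h2n : ∀ j, transfer α lam ω sz n ((skewShift ω)^[(j + 1) * n] p) *
        transfer α lam ω sz n ((skewShift ω)^[j * n] p) =
        transfer α lam ω sz (2 * n) ((skewShift ω)^[j * n] p) := fun j => by
      rw [two_mul, transfer_add, hit]
    have h := avalanche_principle (fun j => transfer α lam ω sz n ((skewShift ω)^[j * n] p))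
      (fun j => transfer α lam ω sz (j * n) p) (fun j => det_transfer hdet _ _)
      (fun j => det_transfer hdet _ _) (by simp [transfer])
      (fun j => by rw [← transfer_add]; ring_nf) hl k
      (fun j hj => hlow _ (hp' j (by omega)))
      (fun j hj => by
        rw [h2n]
        have := hang _ (hp' j (by omega)) (by rw [← hit]; exact hp' (j + 1) (by omega))
        rwa [← hit] at this)
    simp only [h2n] at h
    exact h
  · refine (measure_biUnion_finset_le _ _).trans ?_
    calc _ ≤ ∑ _j ∈ Finset.range (k + 2), ENNReal.ofReal d := by
          refine Finset.sum_le_sum fun j _ => ?_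
          have hT := (measurePreserving_skewShift (ω := ω)).iterate (j * n)
          refine (Measure.le_map_apply hT.measurable.aemeasurable E).trans ?_
          rwa [hT.map_eq]
      _ = ENNReal.ofReal ((k + 2) * d) := by
          rw [Finset.sum_const, Finset.card_range, nsmul_eq_mul,
            ENNReal.ofReal_mul (by positivity)]
          congr 1
          exact_mod_cast (ENNReal.ofReal_natCast (k + 2)).symm

/-- A sequence whose `n`-step increments are nearly constant is nearly linear. -/
lemma abs_sub_linear_le (I : ℕ → ℝ) {P e : ℝ} (hP : 0 ≤ P) (he : 0 ≤ e) {n M K : ℕ}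
    (hn : 0 < n) (hnK : n ≤ K) (hKM : K ≤ M)
    (hI : ∀ m, 0 ≤ I m ∧ I m ≤ m * P) (hlip : ∀ a b, |I (a + b) - I b| ≤ a * P)
    (hstep : ∀ k, (k + 2) * n ≤ M →
      |I ((k + 2) * n) + I n - I (2 * n) - I ((k + 1) * n)| ≤ e) :
    |I K - K * ((I (2 * n) - I n) / n)| ≤ 6 * (n * P) + M * e := by
  have hsum : ∀ k, (k + 1) * n ≤ M →
      |I ((k + 1) * n) - I n - k * (I (2 * n) - I n)| ≤ k * e := by
    intro k
    induction k with
    | zero => simp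
    | succ k ih =>
      intro hk
      have h1 := abs_le.1 (ih (by nlinarith))
      have h2 := abs_le.1 (hstep k hk)
      push_cast
      rw [show k + 1 + 1 = k + 2 by ring, abs_le]
      constructor <;> linarith
  obtain ⟨q, hq⟩ : ∃ q, K / n = q + 1 :=
    Nat.exists_eq_succ_of_ne_zero (Nat.div_pos hnK hn).ne'
  have hK : K % n + (q + 1) * n = K := by
    rw [← hq, mul_comm, Nat.mod_add_div]
  have hr : K % n < n := Nat.mod_lt _ hn
  generalize K % n = r at *
  have h1 := abs_le.1 (hsum q (by omega))
  have h2 := abs_le.1 (hlip r ((q + 1) * n))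
  rw [hK] at h2
  have hqM : (q : ℝ) * e ≤ M * e := by
    gcongr
    nlinarith
  have hn' : (0 : ℝ) < n := by exact_mod_cast hn
  have hr' : (r : ℝ) ≤ n := by exact_mod_cast hr.le
  have hrP : r * P ≤ n * P := by gcongr
  obtain ⟨h3, h4⟩ := hI n
  obtain ⟨h5, h6⟩ := hI (2 * n)
  push_cast at h6
  have hKr : (K : ℝ) * ((I (2 * n) - I n) / n) =
      (q + 1) * (I (2 * n) - I n) + r / n * (I (2 * n) - I n) := by
    rw [← hK]
    push_cast
    field_simp
    ring
  have hrn : (r : ℝ) / n ≤ 1 := (div_le_one hn').2 hr'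
  have hrn0 : 0 ≤ (r : ℝ) / n := by positivity
  have h7 : |(r : ℝ) / n * (I (2 * n) - I n)| ≤ 2 * (n * P) := by
    rw [abs_mul, abs_of_nonneg hrn0]
    refine (mul_le_of_le_one_left (abs_nonneg _) hrn).trans ?_
    rw [abs_le]
    constructor <;> linarith
  have h8 := abs_le.1 h7
  rw [hKr, abs_le]
  constructor <;> linarith

lemma half_le_Pscale {Cα : ℝ} {z : ℂ} (hz : ‖z‖ = 1) (hC : 0 ≤ Cα) (hlam : 0 < lam)
    (hlam1 : lam < 1) : 1 / 2 ≤ Pscale α lam Cα z := by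
  have h1 : (1 : ℝ) ≤ (1 - lam ^ 2)⁻¹ := one_le_inv_iff₀.2 ⟨by nlinarith, by nlinarith⟩
  have h2 : 0 ≤ (Real.sqrt (1 - lam ^ 2 * (⨆ p : Torus2, ‖α p‖) ^ 2))⁻¹ := by positivity
  have h3 := Real.log_le_log two_pos (show 2 ≤ (Real.sqrt (1 - lam ^ 2 *
    (⨆ p : Torus2, ‖α p‖) ^ 2))⁻¹ + Cα + (1 - lam ^ 2)⁻¹ + ‖z‖ by rw [hz]; linarith)
  unfold Pscale
  linarith [Real.log_two_gt_d9]

/-- Under the large deviation estimates at scales `n` and `2n`, the Lyapunov exponents at scales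
between `n` and `2N` are `2 L_{2n} - L_n` up to `O(n P / K)`. -/
lemma abs_mul_LyapFin_sub_le (hcont : ∀ n, Continuous (transfer α lam ω sz n))
    (hdet : ∀ p, (szegoCocycle α lam sz p).det = 1) {P γ : ℝ} (hP : 1 / 2 ≤ P)
    (hbd : ∀ m p, Real.log (matOpNorm (transfer α lam ω sz m p)) ≤ m * P)
    {n N : ℕ} (hn : 0 < n) (hnN : n < N)
    (hE1 : volume {p : Torus2 |
      |(n : ℝ)⁻¹ * Real.log (matOpNorm (transfer α lam ω sz n p)) - LyapFin α lam ω sz n|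
        > γ / 10 * P} ≤ ENNReal.ofReal ((N : ℝ) ^ (-10 : ℝ)))
    (hE2 : volume {p : Torus2 |
      |((2 * n : ℕ) : ℝ)⁻¹ * Real.log (matOpNorm (transfer α lam ω sz (2 * n) p)) -
        LyapFin α lam ω sz (2 * n)| > γ / 10 * P} ≤ ENNReal.ofReal ((N : ℝ) ^ (-10 : ℝ)))
    (hL : γ * P ≤ LyapFin α lam ω sz n)
    (hclose : LyapFin α lam ω sz n - LyapFin α lam ω sz (2 * n) ≤ γ / 40 * P)
    (hlarge : 10 * Real.log (2 * N) ≤ 9 * γ * n * P) {K : ℕ} (hnK : n ≤ K) (hKN : K ≤ 2 * N) :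
    |K * LyapFin α lam ω sz K -
      K * (2 * LyapFin α lam ω sz (2 * n) - LyapFin α lam ω sz n)| ≤ 46 * (n * P) := by
  have hn' : (0 : ℝ) < n := by exact_mod_cast hn
  have hn1 : (1 : ℝ) ≤ n := by exact_mod_cast hn
  have hN2 : (2 : ℝ) ≤ N := by exact_mod_cast (show 2 ≤ N by omega)
  have hmul : ∀ m : ℕ, 0 < m → (m : ℝ) * LyapFin α lam ω sz m =
      ∫ p, Real.log (matOpNorm (transfer α lam ω sz m p)) := fun m hm => by
    have : (m : ℝ) ≠ 0 := by exact_mod_cast hm.ne'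
    rw [LyapFin, mul_inv_cancel_left₀ this]
  set l := 9 / 10 * γ * n * P with hl
  have hexp : 2 * (N : ℝ) ≤ Real.exp l := by
    rw [← Real.log_le_iff_le_exp (by positivity)]
    linarith
  have hexp' : Real.exp (-l) ≤ (2 * (N : ℝ))⁻¹ := by
    rw [Real.exp_neg]
    exact inv_anti₀ (by positivity) hexp
  set E := {p : Torus2 |
      |(n : ℝ)⁻¹ * Real.log (matOpNorm (transfer α lam ω sz n p)) - LyapFin α lam ω sz n|
        > γ / 10 * P} ∪ {p : Torus2 |
      |((2 * n : ℕ) : ℝ)⁻¹ * Real.log (matOpNorm (transfer α lam ω sz (2 * n) p)) -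
        LyapFin α lam ω sz (2 * n)| > γ / 10 * P} with hEdef
  have hE : volume E ≤ ENNReal.ofReal (2 * ((N : ℝ) ^ 2)⁻¹) := by
    have hpow : (N : ℝ) ^ (-10 : ℝ) ≤ ((N : ℝ) ^ 2)⁻¹ := by
      rw [← Real.rpow_natCast, ← Real.rpow_neg (by positivity)]
      exact Real.rpow_le_rpow_of_exponent_le (by linarith) (by norm_num)
    refine (measure_union_le _ _).trans ((add_le_add hE1 hE2).trans ?_)
    rw [← ENNReal.ofReal_add (by positivity) (by positivity)]
    exact ENNReal.ofReal_le_ofReal (by linarith)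
  have hEn : ∀ p ∉ E, |Real.log (matOpNorm (transfer α lam ω sz n p)) -
      n * LyapFin α lam ω sz n| ≤ n * (γ / 10 * P) ∧
      |Real.log (matOpNorm (transfer α lam ω sz (2 * n) p)) -
        2 * n * LyapFin α lam ω sz (2 * n)| ≤ 2 * n * (γ / 10 * P) := by
    intro p hp
    simp only [hEdef, Set.mem_union, Set.mem_ofPred_eq, not_or, gt_iff_lt, not_lt] at hp
    have aux : ∀ a c L D : ℝ, 0 < c → |c⁻¹ * a - L| ≤ D → |a - c * L| ≤ c * D := by
      intro a c L D hc h
      have : a - c * L = c * (c⁻¹ * a - L) := by field_simp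
      rw [this, abs_mul, abs_of_pos hc]
      gcongr
    refine ⟨aux _ _ _ _ hn' hp.1, aux _ _ _ _ (by positivity) ?_⟩
    have := hp.2
    push_cast at this
    exact this
  have hnL := mul_le_mul_of_nonneg_left hL hn'.le
  have hnc := mul_le_mul_of_nonneg_left hclose hn'.le
  have hnP : 1 / 2 ≤ n * P := by nlinarith
  have hstep : ∀ k, (k + 2) * n ≤ 2 * N →
      |(∫ p, Real.log (matOpNorm (transfer α lam ω sz ((k + 2) * n) p))) +
        (∫ p, Real.log (matOpNorm (transfer α lam ω sz n p))) -
        (∫ p, Real.log (matOpNorm (transfer α lam ω sz (2 * n) p))) -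
        ∫ p, Real.log (matOpNorm (transfer α lam ω sz ((k + 1) * n) p))| ≤
        20 * (n * P) * (N : ℝ)⁻¹ := by
    intro k hk
    refine (abs_integral_increment_le hcont hdet (by linarith) hbd (l := l) (by linarith)
      (by positivity) n k E hE (fun p hp => ?_) (fun p hp hp' => ?_)).trans ?_
    · have := (abs_le.1 (hEn p hp).1).1
      linarith
    · have h1 := (abs_le.1 (hEn p hp).1).2
      have h2 := (abs_le.1 (hEn p hp).2).1
      have h3 := (abs_le.1 (hEn _ hp').1).2
      linarith
    · have hk' : (k : ℝ) + 2 ≤ 2 * N := by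
        exact_mod_cast (Nat.le_mul_of_pos_right _ hn).trans hk
      have h1 : ((k : ℝ) + 2) * (2 * ((N : ℝ) ^ 2)⁻¹) ≤ 4 * (N : ℝ)⁻¹ := by
        calc _ ≤ 2 * (N : ℝ) * (2 * ((N : ℝ) ^ 2)⁻¹) := by gcongr
          _ = 4 * (N : ℝ)⁻¹ := by field_simp; norm_num
      have h2 : 0 ≤ n * P := by linarith
      have h3 := mul_le_mul_of_nonneg_left h1 (show 0 ≤ 4 * (n * P) by linarith)
      have h4 : (N : ℝ)⁻¹ ≤ 2 * (n * P) * (N : ℝ)⁻¹ :=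
        le_mul_of_one_le_left (by positivity) (by linarith)
      rw [mul_inv] at hexp'
      linarith
  have hint := integrable_log_matOpNorm_transfer hcont hdet
  have hmain := abs_sub_linear_le
    (fun m => ∫ p, Real.log (matOpNorm (transfer α lam ω sz m p))) (P := P)
    (show 0 ≤ P by linarith) (show 0 ≤ 20 * (n * P) * (N : ℝ)⁻¹ by positivity)
    hn hnK hKN
    (fun m => ⟨integral_nonneg fun p => log_matOpNorm_transfer_nonneg hdet m p, by
      simpa using integral_mono (hint m) (integrable_const (m * P)) (hbd m)⟩)
    (fun a b => by
      rw [← integral_sub (hint _) (hint _)]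
      simpa using norm_integral_le_of_norm_le (μ := (volume : Measure Torus2))
        (f := fun p => Real.log (matOpNorm (transfer α lam ω sz (a + b) p)) -
          Real.log (matOpNorm (transfer α lam ω sz b p))) (integrable_const (a * P))
        (Eventually.of_forall fun p =>
          (abs_log_matOpNorm_transfer_add_sub_le (ω := ω) hdet a b p).trans (hbd a _)))
    hstep
  have h2n := hmul (2 * n) (by omega)
  push_cast at h2n
  simp only [← h2n, ← hmul n hn, ← hmul K (by omega)] at hmain
  have e1 : (2 * n * LyapFin α lam ω sz (2 * n) - n * LyapFin α lam ω sz n) / (n : ℝ) =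
      2 * LyapFin α lam ω sz (2 * n) - LyapFin α lam ω sz n := by
    field_simp
  have e2 : ((2 * N : ℕ) : ℝ) * (20 * (n * P) * (N : ℝ)⁻¹) = 40 * (n * P) := by
    push_cast
    field_simp
    norm_num
  rw [e1, e2] at hmain
  linarith

end LyapunovExponents

/-- **Lemma 3.1, first part** (inductive step for the Lyapunov exponents). There are an
absolute constant `C₀` and a smallness threshold `γ₀` such that: for Diophantine `ω`,
real-analytic `α : 𝕋² → 𝔻`, `λ ∈ (0,1)`, `z ∈ ∂𝔻`, `0 < γ ≤ γ₀` and scales `n < N`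
satisfying the large deviation estimates (i), (ii) at scales `n, 2n`, the lower bound (iii),
the closeness (iv), and the relations (v), one has
`L_N ≥ γP − 2(L_n − L_{2n}) − C₀·n·N⁻¹·P` and `L_N − L_{2N} ≤ C₀·n·N⁻¹·P`. -/
theorem inductive_step_lyapunov :
    ∃ γ₀ > (0:ℝ), ∃ C₀ > (0:ℝ),
      ∀ ε : ℝ, 0 < ε → ∀ ω ∈ DiophSet ε,
      ∀ α : Torus2 → ℂ, (∀ p, ‖α p‖ < 1) → IsRealAnalyticT2 α →
      ∀ lam : ℝ, 0 < lam → lam < 1 →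
      ∀ z sz : ℂ, ‖z‖ = 1 → sz ^ 2 = z →
      ∀ Cα : ℝ, 0 ≤ Cα →
      (∀ m : ℕ, 0 < m → ∀ p : Torus2,
        Real.log (matOpNorm (transfer α lam ω sz m p)) ≤ m * Pscale α lam Cα z) →
      ∀ γ : ℝ, 0 < γ → γ ≤ γ₀ →
      ∀ n N : ℕ, 0 < n → n < N →
      volume {p : Torus2 |
          |(n : ℝ)⁻¹ * Real.log (matOpNorm (transfer α lam ω sz n p)) - LyapFin α lam ω sz n|
            > γ / 10 * Pscale α lam Cα z} ≤ ENNReal.ofReal ((N : ℝ) ^ (-10 : ℝ)) →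
      volume {p : Torus2 |
          |((2 * n : ℕ) : ℝ)⁻¹ * Real.log (matOpNorm (transfer α lam ω sz (2 * n) p)) -
            LyapFin α lam ω sz (2 * n)|
            > γ / 10 * Pscale α lam Cα z} ≤ ENNReal.ofReal ((N : ℝ) ^ (-10 : ℝ)) →
      min (LyapFin α lam ω sz n) (LyapFin α lam ω sz (2 * n)) ≥ γ * Pscale α lam Cα z →
      LyapFin α lam ω sz n - LyapFin α lam ω sz (2 * n) ≤ γ / 40 * Pscale α lam Cα z →
      9 * γ * n * Pscale α lam Cα z ≥ 10 * Real.log (2 * N) →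
      n ^ 2 ≤ N →
      LyapFin α lam ω sz N ≥ γ * Pscale α lam Cα z -
          2 * (LyapFin α lam ω sz n - LyapFin α lam ω sz (2 * n)) -
          C₀ * n * (N : ℝ)⁻¹ * Pscale α lam Cα z ∧
      LyapFin α lam ω sz N - LyapFin α lam ω sz (2 * N) ≤
          C₀ * n * (N : ℝ)⁻¹ * Pscale α lam Cα z := by
  refine ⟨1, one_pos, 100, by norm_num, ?_⟩
  intro ε _ ω _ α hα hαan lam hlam hlam1 z sz hz hsz Cα hCα hbd γ _ _ n N hn hnN hE1 hE2 hL
    hclose hlarge _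
  have hP := half_le_Pscale (α := α) hz hCα hlam hlam1
  have hsz0 : sz ≠ 0 := by
    rintro rfl
    rw [← hsz] at hz
    simp at hz
  have hcont := continuous_transfer (ω := ω) (sz := sz)
    (continuous_of_isRealAnalyticT2 hαan) hα hlam hlam1
  have hdet := det_szegoCocycle hα hlam hlam1 hsz0
  have hbd' : ∀ m p, Real.log (matOpNorm (transfer α lam ω sz m p)) ≤
      m * Pscale α lam Cα z := by
    intro m p
    rcases m.eq_zero_or_pos with rfl | hm
    · simp [transfer, matOpNorm_one]
    · exact hbd m hm p
  have key := fun {K : ℕ} => abs_mul_LyapFin_sub_le (K := K) hcont hdet hP hbd' hn hnN hE1 hE2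
    ((le_min_iff.1 hL).1) hclose hlarge
  have h1 := abs_le.1 (key hnN.le (by omega))
  have h2 := abs_le.1 (key (K := 2 * N) (by omega) le_rfl)
  have hLn := (le_min_iff.1 hL).1
  have hN : (0 : ℝ) < N := by exact_mod_cast hn.trans hnN
  have hnP : 0 ≤ n * Pscale α lam Cα z := mul_nonneg n.cast_nonneg (by linarith)
  have herr : 100 * n * (N : ℝ)⁻¹ * Pscale α lam Cα z =
      100 * (n * Pscale α lam Cα z) / N := by
    field_simp
  push_cast at h2
  rw [herr]
  constructor
  · have : -(46 * (n * Pscale α lam Cα z) / N) ≤ LyapFin α lam ω sz N -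
        (2 * LyapFin α lam ω sz (2 * n) - LyapFin α lam ω sz n) := by
      rw [← neg_div, div_le_iff₀ hN]
      linarith
    have h3 : 46 * (n * Pscale α lam Cα z) / N ≤ 100 * (n * Pscale α lam Cα z) / N := by
      gcongr
      norm_num
    linarith
  · rw [le_div_iff₀ hN]
    linarith
end
end

section
/- (Lemma 4.5, Davis–Simon resolvent bound) Let n be a positive integer, A an n×n complex matrix and z ∈ ℂ with |z| ≥ ‖A‖ (operator norm) and z not in the spectrum of A. Then dist(z, spec(A)) · ‖(z − A)^{−1}‖ ≤ cot(π/(4n)), where dist(z, spec(A)) is the distance from z to the set of eigenvalues of A. -/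
open MeasureTheory Complex Filter Matrix

noncomputable section

open scoped InnerProductSpace

section Schur

variable {E : Type*} [NormedAddCommGroup E] [InnerProductSpace ℂ E] [FiniteDimensional ℂ E]

/-- A compression of `T` to an eigenvector of its adjoint is an eigenvalue of `T`. -/
lemma hasEigenvalue_of_adjoint_apply (T : E →ₗ[ℂ] E) {v : E} (hv : ‖v‖ = 1) {c : ℂ}
    (h : LinearMap.adjoint T v = c • v) : Module.End.HasEigenvalue T ⟪v, T v⟫_ℂ := by
  have hc : ⟪v, T v⟫_ℂ = starRingEnd ℂ c := by
    rw [← LinearMap.adjoint_inner_left, h, inner_smul_left, inner_self_eq_norm_sq_to_K, hv]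
    simp
  rw [hc, Module.End.hasEigenvalue_iff, Module.End.eigenspace_def]
  intro hker
  obtain ⟨x, hx⟩ := LinearMap.injective_iff_surjective.mp (LinearMap.ker_eq_bot.mp hker) v
  have h0 : ⟪v, v⟫_ℂ = 0 := by
    nth_rewrite 2 [← hx]
    simp [← LinearMap.adjoint_inner_left, h, inner_smul_left]
  rw [inner_self_eq_zero] at h0
  simp [h0] at hv

/-- **Schur triangularization**, with the eigenvalues on the diagonal. -/
theorem exists_orthonormal_upperTriangular (n : ℕ) (hn : Module.finrank ℂ E = n)
    (T : E →ₗ[ℂ] E) :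
    ∃ b : Fin n → E, Orthonormal ℂ b ∧ (∀ i j, j < i → ⟪b i, T (b j)⟫_ℂ = 0) ∧
      ∀ i, Module.End.HasEigenvalue T ⟪b i, T (b i)⟫_ℂ := by
  induction n generalizing E with
  | zero => exact ⟨Fin.elim0, ⟨fun i => i.elim0, fun i => i.elim0⟩, fun i => i.elim0,
      fun i => i.elim0⟩
  | succ n ih =>
    have : Nontrivial E := Module.nontrivial_of_finrank_pos (R := ℂ) (by omega)
    obtain ⟨c, hc⟩ := Module.End.exists_eigenvalue (LinearMap.adjoint T)
    obtain ⟨v₀, hv₀⟩ := hc.exists_hasEigenvector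
    obtain ⟨v, hv, hTv⟩ : ∃ v : E, ‖v‖ = 1 ∧ LinearMap.adjoint T v = c • v := by
      refine ⟨((‖v₀‖ : ℂ)⁻¹) • v₀, ?_, ?_⟩
      · rw [norm_smul]
        simp [hv₀.2]
      · rw [map_smul, hv₀.apply_eq_smul, smul_comm]
    have hv0 : v ≠ 0 := by
      rintro rfl
      simp at hv
    have hinv : ∀ w ∈ (ℂ ∙ v)ᗮ, T w ∈ (ℂ ∙ v)ᗮ := by
      intro w hw
      rw [Submodule.mem_orthogonal_singleton_iff_inner_right] at hw ⊢
      rw [← LinearMap.adjoint_inner_left, hTv, inner_smul_left, hw, mul_zero]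
    have hfin : Module.finrank ℂ (ℂ ∙ v)ᗮ = n := by
      have : Fact (Module.finrank ℂ E = n + 1) := ⟨hn⟩
      exact Submodule.finrank_orthogonal_span_singleton hv0
    obtain ⟨b, hb, htri, heig⟩ := ih hfin (T.restrict hinv)
    have hperp : ∀ i, ⟪v, (b i : E)⟫_ℂ = 0 := fun i =>
      Submodule.mem_orthogonal_singleton_iff_inner_right.mp (b i).2
    have hperp' : ∀ i, ⟪(b i : E), v⟫_ℂ = 0 := fun i => inner_eq_zero_symm.mp (hperp i)
    refine ⟨Fin.snoc (fun i => (b i : E)) v, ?_, ?_, ?_⟩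
    · rw [orthonormal_iff_ite] at hb ⊢
      intro i j
      induction i using Fin.lastCases with
      | last =>
        induction j using Fin.lastCases with
        | last => simp [inner_self_eq_norm_sq_to_K, hv]
        | cast j => simp [hperp, (Fin.castSucc_lt_last j).ne']
      | cast i =>
        induction j using Fin.lastCases with
        | last => simp [hperp', (Fin.castSucc_lt_last i).ne]
        | cast j => simpa using hb i j
    · intro i j hij
      induction j using Fin.lastCases with
      | last => exact absurd hij (Fin.le_last i).not_gt
      | cast j =>
        induction i using Fin.lastCases with
        | last =>
          simpa using Submodule.mem_orthogonal_singleton_iff_inner_right.mp (hinv _ (b j).2)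
        | cast i => simpa using htri i j (by simpa using hij)
    · intro i
      induction i using Fin.lastCases with
      | last => simpa using hasEigenvalue_of_adjoint_apply T hv hTv
      | cast i =>
        obtain ⟨w, hw⟩ := (heig i).exists_hasEigenvector
        have hTw := congrArg Subtype.val hw.apply_eq_smul
        refine Module.End.hasEigenvalue_of_hasEigenvector (x := (w : E)) ?_
        rw [Module.End.hasEigenvector_iff, Module.End.mem_eigenspace_iff]
        exact ⟨by simpa using hTw, by simpa using hw.2⟩

end Schur

/-- In an accretive block-triangular pair, the off-diagonal entry is controlled by the diagonal. -/
lemma norm_inner_le_two_of_accretive {E : Type*} [NormedAddCommGroup E] [InnerProductSpace ℂ E]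
    (T : E →ₗ[ℂ] E) {w : ℂ} (hw : w ≠ 0) (hT : ∀ x, 0 ≤ (w * ⟪x, T x⟫_ℂ).re) {e f : E}
    (hfe : ⟪f, T e⟫_ℂ = 0) (he : ‖⟪e, T e⟫_ℂ‖ ≤ 1) (hf : ‖⟪f, T f⟫_ℂ‖ ≤ 1) :
    ‖⟪e, T f⟫_ℂ‖ ≤ 2 := by
  obtain ⟨t, ht, hte⟩ := RCLike.exists_norm_eq_mul_self (w * ⟪e, T f⟫_ℂ)
  have htt : starRingEnd ℂ t * t = 1 := by
    rw [← Complex.normSq_eq_conj_mul_self, Complex.normSq_eq_norm_sq, ht]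
    simp
  have hexp : w * ⟪e - t • f, T (e - t • f)⟫_ℂ
      = w * ⟪e, T e⟫_ℂ + w * ⟪f, T f⟫_ℂ - (‖w * ⟪e, T f⟫_ℂ‖ : ℂ) := by
    have hte' : (‖w * ⟪e, T f⟫_ℂ‖ : ℂ) = t * (w * ⟪e, T f⟫_ℂ) := hte
    rw [hte']
    simp only [map_sub, map_smul, inner_sub_left, inner_sub_right, inner_smul_left,
      inner_smul_right, hfe]
    linear_combination w * ⟪f, T f⟫_ℂ * htt
  have h := hT (e - t • f)
  rw [hexp, Complex.sub_re, Complex.add_re, Complex.ofReal_re, norm_mul] at h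
  have h1 := Complex.re_le_norm (w * ⟪e, T e⟫_ℂ)
  have h2 := Complex.re_le_norm (w * ⟪f, T f⟫_ℂ)
  rw [norm_mul] at h1 h2
  have hw' : 0 < ‖w‖ := norm_pos_iff.mpr hw
  refine le_of_mul_le_mul_left ?_ hw'
  nlinarith

section Trigonometric

/-- The entries of the upper triangular matrix with `1` on and `2` above the diagonal. -/
def davisSimonEntry (i j : ℕ) : ℝ := if i = j then 1 else if i < j then 2 else 0

lemma davisSimonEntry_nonneg (i j : ℕ) : 0 ≤ davisSimonEntry i j := by
  unfold davisSimonEntry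
  split_ifs <;> norm_num

lemma sin_mul_sum_davisSimonEntry_mul_sin (θ : ℝ) (i m : ℕ) (h : i + 1 ≤ m) :
    Real.sin θ * ∑ j ∈ Finset.range m, davisSimonEntry i j * Real.sin ((2 * j + 1) * θ)
      = Real.cos θ * Real.cos ((2 * i + 1) * θ) - Real.cos (2 * m * θ) := by
  induction m, h using Nat.le_induction with
  | base =>
    rw [Finset.sum_range_succ, Finset.sum_eq_zero]
    · have : (2 * ((i + 1 : ℕ) : ℝ) * θ) = (2 * i + 1) * θ + θ := by push_cast; ring
      rw [this, Real.cos_add]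
      simp [davisSimonEntry]
      ring
    · intro j hj
      have := Finset.mem_range.mp hj
      simp [davisSimonEntry, this.ne', this.not_gt]
  | succ m hm ih =>
    rw [Finset.sum_range_succ, mul_add, ih]
    have h1 : (2 * ((m + 1 : ℕ) : ℝ) * θ) = (2 * m + 1) * θ + θ := by push_cast; ring
    have h2 : (2 * (m : ℝ) * θ) = (2 * m + 1) * θ - θ := by ring
    rw [h1, h2, Real.cos_add, Real.cos_sub]
    have h3 : davisSimonEntry i m = 2 := by
      simp [davisSimonEntry, (show i ≠ m by omega), (show i < m by omega)]
    rw [h3]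
    ring

lemma sin_mul_sum_two_mul_cos_odd (θ : ℝ) (j : ℕ) :
    Real.sin θ * ∑ i ∈ Finset.range j, 2 * Real.cos ((2 * i + 1) * θ) = Real.sin (2 * j * θ) := by
  induction j with
  | zero => simp
  | succ m ih =>
    rw [Finset.sum_range_succ, mul_add, ih]
    have h1 : (2 * ((m + 1 : ℕ) : ℝ) * θ) = (2 * m + 1) * θ + θ := by push_cast; ring
    have h2 : (2 * (m : ℝ) * θ) = (2 * m + 1) * θ - θ := by ring
    rw [h1, h2, Real.sin_add, Real.sin_sub]
    ring

lemma sin_mul_sum_davisSimonEntry_mul_cos (θ : ℝ) (j m : ℕ) (h : j + 1 ≤ m) :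
    Real.sin θ * ∑ i ∈ Finset.range m, davisSimonEntry i j * Real.cos ((2 * i + 1) * θ)
      = Real.cos θ * Real.sin ((2 * j + 1) * θ) := by
  induction m, h using Nat.le_induction with
  | base =>
    have h0 : ∑ i ∈ Finset.range j, davisSimonEntry i j * Real.cos ((2 * i + 1) * θ)
        = ∑ i ∈ Finset.range j, 2 * Real.cos ((2 * i + 1) * θ) := by
      refine Finset.sum_congr rfl fun i hi => ?_
      have := Finset.mem_range.mp hi
      simp [davisSimonEntry, this.ne, this]
    rw [Finset.sum_range_succ, mul_add, h0, sin_mul_sum_two_mul_cos_odd]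
    have h2 : (2 * (j : ℝ) * θ) = (2 * j + 1) * θ - θ := by ring
    rw [h2, Real.sin_sub]
    simp [davisSimonEntry]
    ring
  | succ m hm ih =>
    rw [Finset.sum_range_succ, mul_add, ih]
    simp [davisSimonEntry, (show m ≠ j by omega), (show ¬ m < j by omega)]

end Trigonometric

/-- **Schur test** for a nonnegative kernel on a finite type. -/
lemma sum_sq_sum_mul_le_of_schur {ι : Type*} [Fintype ι] (q : ι → ι → ℝ) (u v x : ι → ℝ) (c : ℝ)
    (hq : ∀ i j, 0 ≤ q i j) (hv : ∀ i, 0 < v i)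
    (hrow : ∀ i, ∑ j, q i j * v j = c * u i) (hcol : ∀ j, ∑ i, q i j * u i = c * v j) :
    ∑ i, (∑ j, q i j * x j) ^ 2 ≤ c ^ 2 * ∑ j, x j ^ 2 := by
  calc ∑ i, (∑ j, q i j * x j) ^ 2
      ≤ ∑ i, (∑ j, q i j * v j) * ∑ j, q i j * (x j ^ 2 / v j) := by
        refine Finset.sum_le_sum fun i _ => ?_
        refine Finset.sum_sq_le_sum_mul_sum_of_sq_le_mul _
          (fun j _ => mul_nonneg (hq i j) (hv j).le)
          (fun j _ => mul_nonneg (hq i j) (div_nonneg (sq_nonneg _) (hv j).le)) fun j _ => ?_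
        have := (hv j).ne'
        apply le_of_eq
        field_simp
    _ = ∑ j, ∑ i, c * (x j ^ 2 / v j) * (q i j * u i) := by
        rw [Finset.sum_comm]
        refine Finset.sum_congr rfl fun i _ => ?_
        rw [hrow, Finset.mul_sum]
        exact Finset.sum_congr rfl fun j _ => by ring
    _ = c ^ 2 * ∑ j, x j ^ 2 := by
        rw [Finset.mul_sum]
        refine Finset.sum_congr rfl fun j _ => ?_
        rw [← Finset.mul_sum, hcol]
        have := (hv j).ne'
        field_simp

lemma davisSimon_angle {n : ℕ} {i : ℕ} (hi : i < n) :
    0 < (2 * (i : ℝ) + 1) * (Real.pi / (4 * n)) ∧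
      (2 * (i : ℝ) + 1) * (Real.pi / (4 * n)) < Real.pi / 2 := by
  have hn : (0 : ℝ) < n := by exact_mod_cast (Nat.zero_le i).trans_lt hi
  have hi' : (i : ℝ) + 1 ≤ n := by exact_mod_cast hi
  refine ⟨by positivity, ?_⟩
  rw [mul_div_assoc', div_lt_div_iff₀ (by positivity) (by norm_num)]
  nlinarith [Real.pi_pos]

lemma sum_sq_davisSimonEntry_le {n : ℕ} (hn : 0 < n) (x : Fin n → ℝ) :
    ∑ i : Fin n, (∑ j : Fin n, davisSimonEntry i j * x j) ^ 2
      ≤ Real.cot (Real.pi / (4 * n)) ^ 2 * ∑ j, x j ^ 2 := by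
  set θ := Real.pi / (4 * n) with hθ
  have hs : 0 < Real.sin θ := by
    have h := davisSimon_angle hn
    simp only [Nat.cast_zero, mul_zero, zero_add, one_mul] at h
    exact Real.sin_pos_of_pos_of_lt_pi h.1 (h.2.trans (by linarith [Real.pi_pos]))
  have hcos : Real.cos (2 * n * θ) = 0 := by
    have : 2 * (n : ℝ) * θ = Real.pi / 2 := by
      have : (n : ℝ) ≠ 0 := by exact_mod_cast hn.ne'
      rw [hθ]
      field_simp
      norm_num
    rw [this, Real.cos_pi_div_two]
  refine sum_sq_sum_mul_le_of_schur (fun i j : Fin n => davisSimonEntry i j)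
    (fun i => Real.cos ((2 * (i : ℕ) + 1) * θ)) (fun i => Real.sin ((2 * (i : ℕ) + 1) * θ)) x _
    (fun i j => davisSimonEntry_nonneg i j) (fun i => ?_) (fun i => ?_) (fun j => ?_)
  · have h := davisSimon_angle i.2
    exact Real.sin_pos_of_pos_of_lt_pi h.1 (h.2.trans (by linarith [Real.pi_pos]))
  · rw [Fin.sum_univ_eq_sum_range
      (fun j => davisSimonEntry i j * Real.sin ((2 * (j : ℝ) + 1) * θ)) n,
      Real.cot_eq_cos_div_sin, div_mul_eq_mul_div, eq_div_iff hs.ne', mul_comm,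
      sin_mul_sum_davisSimonEntry_mul_sin θ i n i.2, hcos, sub_zero]
  · rw [Fin.sum_univ_eq_sum_range
      (fun i => davisSimonEntry i j * Real.cos ((2 * (i : ℝ) + 1) * θ)) n,
      Real.cot_eq_cos_div_sin, div_mul_eq_mul_div, eq_div_iff hs.ne', mul_comm,
      sin_mul_sum_davisSimonEntry_mul_cos θ j n j.2]

lemma cot_pi_div_four_mul_nonneg {n : ℕ} (hn : 0 < n) : 0 ≤ Real.cot (Real.pi / (4 * n)) := by
  have h := davisSimon_angle hn
  simp only [Nat.cast_zero, mul_zero, zero_add, one_mul] at h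
  rw [Real.cot_eq_cos_div_sin]
  exact div_nonneg (Real.cos_nonneg_of_mem_Icc ⟨by linarith [Real.pi_pos], h.2.le⟩)
    (Real.sin_nonneg_of_nonneg_of_le_pi h.1.le (by linarith [Real.pi_pos]))

/-- An operator whose matrix in an orthonormal basis is dominated entrywise by the upper
triangular matrix with `1` on and `2` above the diagonal has norm at most `cot (π / (4n))`. -/
lemma norm_apply_le_cot_mul {E : Type*} [NormedAddCommGroup E] [InnerProductSpace ℂ E]
    {n : ℕ} (hn : 0 < n) (b : OrthonormalBasis (Fin n) ℂ E) (T : E →ₗ[ℂ] E)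
    (hT : ∀ i j : Fin n, ‖⟪b i, T (b j)⟫_ℂ‖ ≤ davisSimonEntry i j) (x : E) :
    ‖T x‖ ≤ Real.cot (Real.pi / (4 * n)) * ‖x‖ := by
  refine le_of_sq_le_sq ?_ (mul_nonneg (cot_pi_div_four_mul_nonneg hn) (norm_nonneg x))
  rw [mul_pow, ← b.sum_sq_norm_inner_right (T x), ← b.sum_sq_norm_inner_right x]
  refine le_trans (Finset.sum_le_sum fun i _ => ?_)
    (sum_sq_davisSimonEntry_le hn fun j => ‖⟪b j, x⟫_ℂ‖)
  gcongr
  calc ‖⟪b i, T x⟫_ℂ‖ = ‖∑ j, ⟪b j, x⟫_ℂ * ⟪b i, T (b j)⟫_ℂ‖ := by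
        conv_lhs => rw [← b.sum_repr' x]
        simp
    _ ≤ ∑ j, ‖⟪b j, x⟫_ℂ * ⟪b i, T (b j)⟫_ℂ‖ := norm_sum_le _ _
    _ ≤ ∑ j : Fin n, davisSimonEntry i j * ‖⟪b j, x⟫_ℂ‖ := by
        refine Finset.sum_le_sum fun j _ => ?_
        rw [norm_mul, mul_comm]
        gcongr
        exact hT i j

/-- An operator that is accretive up to a nonzero factor and whose eigenvalues lie in the closed
unit disc has norm at most `cot (π / (4n))`. -/
theorem norm_le_cot_of_accretive {E : Type*} [NormedAddCommGroup E] [InnerProductSpace ℂ E]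
    [FiniteDimensional ℂ E] {n : ℕ} (hn : 0 < n) (hE : Module.finrank ℂ E = n) (T : E →L[ℂ] E)
    {w : ℂ} (hw : w ≠ 0) (hT : ∀ x, 0 ≤ (w * ⟪x, T x⟫_ℂ).re)
    (heig : ∀ μ, Module.End.HasEigenvalue (T : E →ₗ[ℂ] E) μ → ‖μ‖ ≤ 1) :
    ‖T‖ ≤ Real.cot (Real.pi / (4 * n)) := by
  obtain ⟨b, hb, htri, hdiag⟩ := exists_orthonormal_upperTriangular n hE (T : E →ₗ[ℂ] E)
  have : Nonempty (Fin n) := ⟨⟨0, hn⟩⟩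
  let B := basisOfOrthonormalOfCardEqFinrank hb (by simp [hE])
  have hB : ⇑B = b := coe_basisOfOrthonormalOfCardEqFinrank hb (by simp [hE])
  refine T.opNorm_le_bound (cot_pi_div_four_mul_nonneg hn) fun x =>
    norm_apply_le_cot_mul hn (B.toOrthonormalBasis (hB ▸ hb)) (T : E →ₗ[ℂ] E) (fun i j => ?_) x
  rw [Module.Basis.coe_toOrthonormalBasis, hB]
  rcases lt_trichotomy i j with h | rfl | h
  · simpa [davisSimonEntry, h, h.ne, Fin.val_inj] using
      norm_inner_le_two_of_accretive (T : E →ₗ[ℂ] E) hw hT (htri j i h) (heig _ (hdiag i))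
        (heig _ (hdiag j))
  · simpa [davisSimonEntry] using heig _ (hdiag i)
  · simpa [davisSimonEntry, h.ne', h.not_gt, Fin.val_inj] using htri i j h

/-- **Lemma 4.5** (Davis–Simon resolvent bound). If `A` is an `n×n` complex matrix and
`z ∈ ℂ` satisfies `|z| ≥ ‖A‖` and `z ∉ spec(A)`, then
`dist(z, spec(A)) · ‖(z − A)⁻¹‖ ≤ cot(π/(4n))`. -/
theorem davis_simon_resolvent_bound (n : ℕ) (hn : 0 < n)
    (A : Matrix (Fin n) (Fin n) ℂ) (z : ℂ)
    (hz : matOpNorm A ≤ ‖z‖) (hspec : z ∉ spectrum ℂ A) :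
    Metric.infDist z (spectrum ℂ A) *
        matOpNorm ((z • (1 : Matrix (Fin n) (Fin n) ℂ) - A)⁻¹) ≤
      Real.cot (Real.pi / (4 * n)) := by
  have : Nonempty (Fin n) := ⟨⟨0, hn⟩⟩
  have hM : IsUnit (z • (1 : Matrix (Fin n) (Fin n) ℂ) - A) := by
    rwa [spectrum.notMem_iff, Algebra.algebraMap_eq_smul_one] at hspec
  have hz0 : z ≠ 0 := by
    rintro rfl
    have hA : A = 0 := by
      have : Matrix.toEuclideanCLM (𝕜 := ℂ) A = 0 :=
        norm_le_zero_iff.mp (by simpa [matOpNorm] using hz)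
      simpa using this
    simp [hA] at hM
  set M := z • (1 : Matrix (Fin n) (Fin n) ℂ) - A with hMdef
  set d := Metric.infDist z (spectrum ℂ A)
  have hd : 0 ≤ d := Metric.infDist_nonneg
  set Ac := Matrix.toEuclideanCLM (𝕜 := ℂ) A with hAc
  set R := Matrix.toEuclideanCLM (𝕜 := ℂ) M⁻¹ with hR
  have hMR : ∀ x, z • R x - Ac (R x) = x := by
    intro x
    have h : Matrix.toEuclideanCLM (𝕜 := ℂ) M * R = 1 := by
      rw [hR, ← map_mul, Matrix.mul_nonsing_inv _ ((Matrix.isUnit_iff_isUnit_det _).mp hM), map_one]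
    have h' := congrArg (fun S : _ →L[ℂ] _ => S x) h
    simpa [hMdef, map_sub, map_smul] using h'
  have hnorm : d * matOpNorm M⁻¹ = ‖(d : ℂ) • R‖ := by
    rw [norm_smul, Complex.norm_real, Real.norm_of_nonneg hd, matOpNorm]
  rw [hnorm]
  refine norm_le_cot_of_accretive hn (by simp) _ hz0 (fun x => ?_) fun μ hμ => ?_
  · set y := R x
    have hx : x = z • y - Ac y := (hMR x).symm
    have h1 : ‖z * ⟪Ac y, y⟫_ℂ‖ ≤ ‖z‖ ^ 2 * ‖y‖ ^ 2 := by
      have hA : ‖Ac y‖ ≤ ‖z‖ * ‖y‖ := (Ac.le_opNorm y).trans (by gcongr; exact hz)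
      calc ‖z * ⟪Ac y, y⟫_ℂ‖ = ‖z‖ * ‖⟪Ac y, y⟫_ℂ‖ := norm_mul _ _
        _ ≤ ‖z‖ * (‖Ac y‖ * ‖y‖) := by gcongr; exact norm_inner_le_norm _ _
        _ ≤ ‖z‖ * (‖z‖ * ‖y‖ * ‖y‖) := by gcongr
        _ = ‖z‖ ^ 2 * ‖y‖ ^ 2 := by ring
    have h2 : z * ⟪x, ((d : ℂ) • R) x⟫_ℂ
        = (d : ℂ) * (((‖z‖ ^ 2 * ‖y‖ ^ 2 : ℝ) : ℂ) - z * ⟪Ac y, y⟫_ℂ) := by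
      have hyy : ⟪y, y⟫_ℂ = (‖y‖ : ℂ) ^ 2 := inner_self_eq_norm_sq_to_K y
      have hzz : z * starRingEnd ℂ z = (‖z‖ : ℂ) ^ 2 := Complex.mul_conj' z
      change z * ⟪x, (d : ℂ) • y⟫_ℂ = _
      rw [hx, inner_smul_right, inner_sub_left, inner_smul_left, hyy]
      push_cast
      linear_combination (d : ℂ) * (‖y‖ : ℂ) ^ 2 * hzz
    rw [h2, Complex.re_ofReal_mul, Complex.sub_re, Complex.ofReal_re]
    exact mul_nonneg hd (sub_nonneg.mpr ((Complex.re_le_norm _).trans h1))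
  · obtain ⟨x, hx⟩ := hμ.exists_hasEigenvector
    have hdx : (d : ℂ) • R x = μ • x := hx.apply_eq_smul
    rcases eq_or_ne μ 0 with rfl | hμ0
    · simp
    have hAx : Ac x = (z - d / μ) • x := by
      have hAR : Ac (R x) = z • R x - x := (sub_eq_of_eq_add (sub_eq_iff_eq_add'.mp (hMR x))).symm
      have h : μ • Ac x = z • μ • x - (d : ℂ) • x := by
        rw [← map_smul, ← hdx, map_smul, hAR, smul_sub, smul_comm]
      have hd' : z - d / μ = μ⁻¹ * (z * μ - d) := by field_simp
      rw [hd', mul_smul, sub_smul, mul_smul, ← h, inv_smul_smul₀ hμ0]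
    have hmem : z - d / μ ∈ spectrum ℂ A := by
      rw [← AlgEquiv.spectrum_eq (Matrix.toEuclideanCLM (n := Fin n) (𝕜 := ℂ)) A,
        ContinuousLinearMap.spectrum_eq]
      exact (Module.End.hasEigenvalue_of_hasEigenvector
        ⟨Module.End.mem_eigenspace_iff.mpr hAx, hx.2⟩).mem_spectrum
    have hle : d ≤ dist z (z - d / μ) := Metric.infDist_le_dist_of_mem hmem
    rw [dist_eq_norm, sub_sub_cancel, norm_div, Complex.norm_real, Real.norm_of_nonneg hd,
      le_div_iff₀ (norm_pos_iff.mpr hμ0)] at hle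
    have hd0 : d ≠ 0 := by
      intro h0
      rw [h0, Complex.ofReal_zero, zero_smul, eq_comm, smul_eq_zero] at hdx
      exact hdx.elim hμ0 hx.2
    exact le_of_mul_le_mul_left (by simpa using hle) (hd.lt_of_ne' hd0)
end
end

section
/- (Lemma 4.6: elimination of double resonances, measure estimate) Fix ε > 0 small, β, γ ∈ ∂𝔻, a constant C₁ ≥ 1 and c₀ > 0. Let α : 𝕋² → 𝔻 be a nonconstant trigonometric polynomial and λ ∈ (0,1). Assume inf_{z ∈ ∂𝔻} L(z) > c₀ and assume the large deviation estimate: there is σ > 0 such that for all z ∈ ∂𝔻 and all ω with ‖kω‖ ≥ ε·k^{−1}·(1 + log k)^{−2} for all integers 0 < k < N, one has mes[(x,y) ∈ 𝕋² : |(1/N)·log‖M_N^z(x,y)‖ − L_N(z)| > c₀/20] ≤ e^{−N^σ}. Let C₂ be a sufficiently large constant depending on α, and let N be a positive integer. Define S = S_N ⊂ 𝕋⁴ × ∂𝔻 as the set of (ω, y₀, x, y, z) for which there exists some N₁ < N^{C₁} such that: (i) ‖kω‖ ≥ ε·k^{−1}·(1 + log k)^{−2} for all integers k with 0 < k < N;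 (ii) ‖(𝓔^{β,γ}_{[−N₁,N₁]}(ω, 0, y₀) − z)^{−1}‖ > e^{C₂·N}, where 𝓔^{β,γ}_{[−N₁,N₁]}(ω, 0, y₀) is the finite CMV matrix built from the coefficients α_j(0, y₀) = λ·α(T_ω^j(0, y₀)), −N₁ ≤ j ≤ N₁; and (iii) (1/N)·log‖M_N^z(x,y)‖ < L_N(z) − c₀/10. Then there is a constant C such that mes(Proj_{𝕋⁴} S) ≤ C·e^{−(1/2)·N^σ}. -/
open MeasureTheory Complex Filter Matrix

noncomputable section

/-- `ρ_n = (1 − |α_n|²)^{1/2}` for a bi-infinite coefficient sequence. -/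
def rhoSeq (a : ℤ → ℂ) (n : ℤ) : ℝ := Real.sqrt (1 - ‖a n‖ ^ 2)

/-- Entries of the factor `𝓛 = ⊕_j Θ_{2j}` of the extended CMV matrix, where
`Θ_n = [[conj α_n, ρ_n], [ρ_n, −α_n]]` acts on coordinates `(n, n+1)`. -/
def cmvL (a : ℤ → ℂ) (i j : ℤ) : ℂ :=
  if Even i then
    (if j = i then (starRingEnd ℂ) (a i) else if j = i + 1 then (rhoSeq a i : ℂ) else 0)
  else
    (if j = i - 1 then (rhoSeq a (i - 1) : ℂ) else if j = i then -(a (i - 1)) else 0)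

/-- Entries of the factor `𝓜 = ⊕_j Θ_{2j+1}` of the extended CMV matrix. -/
def cmvM (a : ℤ → ℂ) (i j : ℤ) : ℂ :=
  if Odd i then
    (if j = i then (starRingEnd ℂ) (a i) else if j = i + 1 then (rhoSeq a i : ℂ) else 0)
  else
    (if j = i - 1 then (rhoSeq a (i - 1) : ℂ) else if j = i then -(a (i - 1)) else 0)

/-- Entries of the extended CMV matrix `𝓔 = 𝓛𝓜` (the inner sum is finite since row `i`
of `𝓛` has its nonzero entries in columns `i−1, i, i+1`). -/
def cmvE (a : ℤ → ℂ) (i j : ℤ) : ℂ :=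
  ∑ k ∈ Finset.Icc (i - 1) (i + 1), cmvL a i k * cmvM a k j

/-- The action of the (pentadiagonal) extended CMV matrix `𝓔` on a sequence. -/
def cmvApply (a : ℤ → ℂ) (ξ : ℤ → ℂ) (i : ℤ) : ℂ :=
  ∑ j ∈ Finset.Icc (i - 2) (i + 2), cmvE a i j * ξ j

/-- The coefficient sequence modified at the boundary: `α_{a−1}` replaced by `β`, `α_b` by `γ`. -/
def modCoeff (a b : ℤ) (β γ : ℂ) (c : ℤ → ℂ) : ℤ → ℂ :=
  fun n => if n = a - 1 then β else if n = b then γ else c n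

/-- The finite matrix `𝓛^{β,γ}_{[a,b]}`. -/
def finCMV_L (a b : ℤ) (β γ : ℂ) (c : ℤ → ℂ) : Matrix (Set.Icc a b) (Set.Icc a b) ℂ :=
  fun i j => cmvL (modCoeff a b β γ c) i j

/-- The finite matrix `𝓜^{β,γ}_{[a,b]}`. -/
def finCMV_M (a b : ℤ) (β γ : ℂ) (c : ℤ → ℂ) : Matrix (Set.Icc a b) (Set.Icc a b) ℂ :=
  fun i j => cmvM (modCoeff a b β γ c) i j

/-- The finite CMV matrix `𝓔^{β,γ}_{[a,b]} = 𝓛^{β,γ}_{[a,b]} · 𝓜^{β,γ}_{[a,b]}`. -/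
def finCMV_E (a b : ℤ) (β γ : ℂ) (c : ℤ → ℂ) : Matrix (Set.Icc a b) (Set.Icc a b) ℂ :=
  finCMV_L a b β γ c * finCMV_M a b β γ c

/-- The finite-volume Green's function
`G^{β,γ}_{[a,b]}(z) = (z·(𝓛^{β,γ}_{[a,b]})* − 𝓜^{β,γ}_{[a,b]})^{−1}`. -/
def greenFn (a b : ℤ) (β γ : ℂ) (c : ℤ → ℂ) (z : ℂ) :
    Matrix (Set.Icc a b) (Set.Icc a b) ℂ :=
  (z • (finCMV_L a b β γ c)ᴴ - finCMV_M a b β γ c)⁻¹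

/-- The skew-shift Verblunsky coefficients `α_n(x,y) = λ·α(T_ω^n(x,y))`, `n ∈ ℤ`. -/
def skewCoeff (α : Torus2 → ℂ) (lam : ℝ) (ω : Torus) (p : Torus2) (n : ℤ) : ℂ :=
  (lam : ℂ) * α (skewIter ω n p)

/-! ### Unitarity of the finite CMV matrices -/

lemma rhoSeq_sq {a : ℤ → ℂ} {n : ℤ} (h : ‖a n‖ ≤ 1) :
    (rhoSeq a n : ℂ) * rhoSeq a n = 1 - a n * (starRingEnd ℂ) (a n) := by
  rw [Complex.mul_conj, Complex.normSq_eq_norm_sq, ← Complex.ofReal_mul, rhoSeq,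
    Real.mul_self_sqrt (by nlinarith [norm_nonneg (a n)])]
  push_cast
  rfl

lemma rhoSeq_eq_zero {a : ℤ → ℂ} {n : ℤ} (h : ‖a n‖ = 1) : rhoSeq a n = 0 := by
  simp [rhoSeq, h]

lemma sum_Icc_sub_one_add_one (f : ℤ → ℂ) (i : ℤ) :
    ∑ k ∈ Finset.Icc (i - 1) (i + 1), f k = f (i - 1) + f i + f (i + 1) := by
  have h : Finset.Icc (i - 1) (i + 1) = {i - 1, i, i + 1} := by
    ext k
    simp only [Finset.mem_Icc, Finset.mem_insert, Finset.mem_singleton]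
    omega
  have h1 : i - 1 ∉ ({i, i + 1} : Finset ℤ) := by
    simp only [Finset.mem_insert, Finset.mem_singleton]
    omega
  rw [h, Finset.sum_insert h1, Finset.sum_insert (by simp), Finset.sum_singleton, add_assoc]

lemma cmvL_two_mul (a : ℤ → ℂ) (m j : ℤ) :
    cmvL a (2 * m) j = if j = 2 * m then (starRingEnd ℂ) (a (2 * m))
      else if j = 2 * m + 1 then (rhoSeq a (2 * m) : ℂ) else 0 := by
  simp [cmvL]

lemma cmvL_two_mul_add_one (a : ℤ → ℂ) (m j : ℤ) :
    cmvL a (2 * m + 1) j = if j = 2 * m then (rhoSeq a (2 * m) : ℂ)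
      else if j = 2 * m + 1 then -(a (2 * m)) else 0 := by
  simp [cmvL]

lemma cmvL_eq_zero {a : ℤ → ℂ} {i k : ℤ} (hk : k ∉ Finset.Icc (i - 1) (i + 1)) :
    cmvL a i k = 0 := by
  simp only [Finset.mem_Icc] at hk
  unfold cmvL
  split_ifs <;> first | rfl | omega

lemma cmvL_left_boundary {a : ℤ → ℂ} {i : ℤ} (h : ‖a (i - 1)‖ = 1) : cmvL a i (i - 1) = 0 := by
  unfold cmvL
  split_ifs <;> first | rfl | omega | simp [rhoSeq_eq_zero h]

lemma cmvL_right_boundary {a : ℤ → ℂ} {i : ℤ} (h : ‖a i‖ = 1) : cmvL a i (i + 1) = 0 := by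
  unfold cmvL
  split_ifs <;> first | rfl | omega | simp [rhoSeq_eq_zero h]

lemma cmvL_mul_conj_eq_zero {i j : ℤ} (h : i / 2 ≠ j / 2) (a : ℤ → ℂ) (k : ℤ) :
    cmvL a i k * (starRingEnd ℂ) (cmvL a j k) = 0 := by
  obtain ⟨m, rfl | rfl⟩ := Int.even_or_odd' i <;> obtain ⟨l, rfl | rfl⟩ := Int.even_or_odd' j <;>
  simp only [cmvL_two_mul, cmvL_two_mul_add_one] <;>
  split_ifs <;> first | omega | simp

lemma cmvL_orthonormal {a : ℤ → ℂ} (ha : ∀ n, ‖a n‖ ≤ 1) (i j : ℤ) :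
    ∑ k ∈ Finset.Icc (i - 1) (i + 1), cmvL a i k * (starRingEnd ℂ) (cmvL a j k) =
      if i = j then 1 else 0 := by
  by_cases hij : i / 2 = j / 2
  · rw [sum_Icc_sub_one_add_one]
    obtain ⟨m, hi⟩ := Int.even_or_odd' i
    obtain ⟨l, hj⟩ := Int.even_or_odd' j
    obtain rfl : m = l := by omega
    have h1 : ¬ (2 * m + 1 = 2 * m) := by omega
    have h2 : ¬ (2 * m = 2 * m + 1) := by omega
    have h3 : ¬ (2 * m - 1 = 2 * m) := by omega
    have h4 : ¬ (2 * m - 1 = 2 * m + 1) := by omega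
    have h5 : ¬ (2 * m + 1 + 1 = 2 * m) := by omega
    have h6 : ¬ (2 * m + 1 + 1 = 2 * m + 1) := by omega
    have hr := rhoSeq_sq (ha (2 * m))
    obtain rfl | rfl := hi <;> obtain rfl | rfl := hj <;>
    simp only [cmvL_two_mul, cmvL_two_mul_add_one, add_sub_cancel_right, h1, h2, h3, h4, h5, h6,
      if_true, if_false, map_zero, map_neg, Complex.conj_conj, Complex.conj_ofReal]
    · linear_combination hr
    · ring
    · ring
    · linear_combination hr
  · rw [Finset.sum_eq_zero fun k _ => cmvL_mul_conj_eq_zero hij a k, if_neg]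
    rintro rfl
    exact hij rfl

lemma cmvM_eq_cmvL (a : ℤ → ℂ) (i j : ℤ) :
    cmvM a i j = cmvL (fun n => a (n - 1)) (i + 1) (j + 1) := by
  have h : Even (i + 1) ↔ Odd i := by simp
  simp only [cmvM, cmvL, h, rhoSeq, add_sub_cancel_right]
  split_ifs <;> first | rfl | omega

/-- A banded array whose rows are orthonormal and do not leave the interval `[a, b]` restricts to a
unitary matrix on `[a, b]`. -/
lemma mem_unitaryGroup_of_rows {a b : ℤ} {g : ℤ → ℤ → ℂ}
    (hband : ∀ i k, k ∉ Finset.Icc (i - 1) (i + 1) → g i k = 0)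
    (horth : ∀ i j, ∑ k ∈ Finset.Icc (i - 1) (i + 1), g i k * (starRingEnd ℂ) (g j k) =
      if i = j then 1 else 0)
    (hleft : g a (a - 1) = 0) (hright : g b (b + 1) = 0) :
    Matrix.of (fun i j : Set.Icc a b => g i j) ∈
      Matrix.unitaryGroup (Set.Icc a b) ℂ := by
  rw [Matrix.mem_unitaryGroup_iff]
  ext i j
  have hsum : ∑ k : Set.Icc a b, g i k * (starRingEnd ℂ) (g j k) =
      ∑ k ∈ Finset.Icc a b, g i k * (starRingEnd ℂ) (g j k) := by
    rw [← Finset.sum_coe_sort (Finset.Icc a b)]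
    exact Fintype.sum_equiv (Equiv.subtypeEquivRight (by simp)) _ _ (fun _ => rfl)
  have hi := i.2
  simp only [Set.mem_Icc] at hi
  have hext : ∑ k ∈ Finset.Icc a b, g i k * (starRingEnd ℂ) (g j k) =
      ∑ k ∈ Finset.Icc ((i : ℤ) - 1) (i + 1), g i k * (starRingEnd ℂ) (g j k) := by
    refine (Finset.sum_subset (Finset.inter_subset_left
      (s₂ := Finset.Icc ((i : ℤ) - 1) (i + 1))) ?_).symm.trans
      (Finset.sum_subset (Finset.inter_subset_right (s₁ := Finset.Icc a b)) ?_)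
    · intro k hk hk'
      rw [hband i k fun h => hk' (Finset.mem_inter.2 ⟨hk, h⟩), zero_mul]
    · intro k hk hk'
      have : ((i : ℤ) = a ∧ k = a - 1) ∨ ((i : ℤ) = b ∧ k = b + 1) := by
        simp only [Finset.mem_inter, Finset.mem_Icc] at hk hk'
        omega
      obtain ⟨h, rfl⟩ | ⟨h, rfl⟩ := this
      · rw [h, hleft, zero_mul]
      · rw [h, hright, zero_mul]
  simp only [Matrix.mul_apply, Matrix.star_apply, Matrix.one_apply, Matrix.of_apply, ← Subtype.coe_inj]
  exact (hsum.trans hext).trans (horth i j)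

lemma norm_modCoeff_le {a b : ℤ} {β γ : ℂ} {c : ℤ → ℂ} (hβ : ‖β‖ = 1) (hγ : ‖γ‖ = 1)
    (hc : ∀ n, ‖c n‖ ≤ 1) (n : ℤ) : ‖modCoeff a b β γ c n‖ ≤ 1 := by
  unfold modCoeff
  split_ifs
  exacts [hβ.le, hγ.le, hc n]

lemma finCMV_E_mem_unitaryGroup {a b : ℤ} (hab : a ≤ b) {β γ : ℂ} {c : ℤ → ℂ} (hβ : ‖β‖ = 1)
    (hγ : ‖γ‖ = 1) (hc : ∀ n, ‖c n‖ ≤ 1) :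
    finCMV_E a b β γ c ∈ Matrix.unitaryGroup (Set.Icc a b) ℂ := by
  have hle := norm_modCoeff_le (a := a) (b := b) hβ hγ hc
  have hl : ‖modCoeff a b β γ c (a - 1)‖ = 1 := by simpa [modCoeff] using hβ
  have hr : ‖modCoeff a b β γ c b‖ = 1 := by
    rw [modCoeff, if_neg (by omega), if_pos rfl, hγ]
  have hL : finCMV_L a b β γ c ∈ Matrix.unitaryGroup (Set.Icc a b) ℂ :=
    mem_unitaryGroup_of_rows (g := cmvL (modCoeff a b β γ c)) (fun _ _ => cmvL_eq_zero)
      (cmvL_orthonormal hle) (cmvL_left_boundary hl) (cmvL_right_boundary hr)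
  have hM : finCMV_M a b β γ c ∈ Matrix.unitaryGroup (Set.Icc a b) ℂ := by
    refine mem_unitaryGroup_of_rows (g := cmvM (modCoeff a b β γ c)) ?_ ?_ ?_ ?_
    · intro i k hk
      rw [cmvM_eq_cmvL]
      exact cmvL_eq_zero (by simp only [Finset.mem_Icc] at hk ⊢; omega)
    · intro i j
      have h := cmvL_orthonormal (fun n => hle (n - 1)) (i + 1) (j + 1)
      simp only [cmvM_eq_cmvL]
      rw [sum_Icc_sub_one_add_one] at h ⊢
      simpa using h
    · rw [cmvM_eq_cmvL]
      have := cmvL_left_boundary (a := fun n => modCoeff a b β γ c (n - 1)) (i := a + 1)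
        (by simpa using hl)
      simpa using this
    · rw [cmvM_eq_cmvL]
      exact cmvL_right_boundary (by simpa using hr)
  exact mul_mem hL hM

section Resolvent

open scoped Matrix.Norms.L2Operator

/-- A unitary matrix with a large resolvent at `z` has an eigenvalue close to `z`. -/
lemma exists_eigenvalue_near_of_lt_norm_inv {n : Type*} [Fintype n] [DecidableEq n] [Nonempty n]
    {U : Matrix n n ℂ} (hU : U ∈ Matrix.unitaryGroup n ℂ) {z : ℂ} {R : ℝ} (hR : 0 < R)
    (h : R < matOpNorm ((U - z • (1 : Matrix n n ℂ))⁻¹)) :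
    ∃ w : ℂ, ‖w‖ = 1 ∧ w ∈ spectrum ℂ U ∧ ‖z - w‖ ≤ R⁻¹ := by
  set B := U - z • (1 : Matrix n n ℂ) with hB
  change R < ‖B⁻¹‖ at h
  have hunit : IsUnit B := by
    by_contra hn
    rw [Matrix.isUnit_iff_isUnit_det] at hn
    rw [Matrix.nonsing_inv_apply_not_isUnit _ hn, norm_zero] at h
    exact absurd h hR.not_gt
  have hnormal : IsStarNormal B⁻¹ := by
    have hUU := (isStarNormal_of_mem_unitary hU).star_comm_self
    have hBB : Commute (Bᴴ) B := by
      simp only [hB, Matrix.conjTranspose_sub, Matrix.conjTranspose_smul,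
        Matrix.conjTranspose_one]
      exact ((hUU.sub_right ((Commute.one_right _).smul_right z)).sub_left
        (((Commute.one_left _).smul_left _)))
    refine ⟨?_⟩
    change (B⁻¹)ᴴ * B⁻¹ = B⁻¹ * (B⁻¹)ᴴ
    rw [Matrix.conjTranspose_nonsing_inv, ← Matrix.mul_inv_rev, ← Matrix.mul_inv_rev, hBB.eq]
  obtain ⟨k, hk, hknorm⟩ := spectrum.exists_nnnorm_eq_spectralRadius (B⁻¹)
  rw [IsStarNormal.spectralRadius_eq_nnnorm, ENNReal.coe_inj] at hknorm
  have hknorm' : ‖k‖ = ‖B⁻¹‖ := congrArg NNReal.toReal hknorm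
  have hk0 : k ≠ 0 := by
    rw [← norm_pos_iff, hknorm']
    exact hR.trans h
  obtain ⟨u, hu⟩ := hunit
  have hkB : k⁻¹ ∈ spectrum ℂ B := by
    rw [← hu, ← Matrix.coe_units_inv] at hk
    have := (spectrum.inv_mem_iff (r := (Units.mk0 k hk0)⁻¹) (a := u)).2 (by simpa using hk)
    simpa [hu] using this
  have hw : z + k⁻¹ ∈ spectrum ℂ U := by
    rw [add_comm, spectrum.add_mem_iff]
    convert hkB using 1
    rw [hB, Algebra.algebraMap_eq_smul_one]
    abel_nf
  refine ⟨z + k⁻¹, ?_, hw, ?_⟩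
  · simpa using Unitary.spectrum_subset_circle ⟨U, hU⟩ hw
  · rw [sub_add_cancel_left, norm_neg, norm_inv, hknorm']
    exact inv_anti₀ hR h.le

end Resolvent

/-! ### Regularity of the transfer matrices -/

lemma IsTrigPoly.continuous {α : Torus2 → ℂ} (h : IsTrigPoly α) : Continuous α := by
  obtain ⟨F, c, hF⟩ := h
  rw [show α = _ from funext hF]
  have hc : Continuous (AddCircle.toCircle (T := (1 : ℝ))) := AddCircle.continuous_toCircle
  fun_prop

lemma norm_smul_coeff_lt {α : Torus2 → ℂ} (hα : ∀ p, ‖α p‖ < 1) {lam : ℝ} (h0 : 0 < lam)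
    (h1 : lam < 1) (p : Torus2) : ‖(lam : ℂ) * α p‖ < 1 := by
  rw [norm_mul, Complex.norm_real, Real.norm_of_nonneg h0.le]
  nlinarith [hα p, norm_nonneg (α p)]

section Transfer

open scoped Matrix.Norms.L2Operator

variable {α : Torus2 → ℂ} {lam : ℝ}

lemma sqrt_one_sub_norm_sq_pos (ha : ∀ p, ‖(lam : ℂ) * α p‖ < 1) (p : Torus2) :
    0 < Real.sqrt (1 - ‖(lam : ℂ) * α p‖ ^ 2) :=
  Real.sqrt_pos.2 (by nlinarith [ha p, norm_nonneg ((lam : ℂ) * α p)])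

lemma continuous_inv_sqrt_one_sub_norm_sq (hc : Continuous α)
    (ha : ∀ p, ‖(lam : ℂ) * α p‖ < 1) :
    Continuous fun p => ((Real.sqrt (1 - ‖(lam : ℂ) * α p‖ ^ 2) : ℂ))⁻¹ := by
  have h : Continuous fun p => (Real.sqrt (1 - ‖(lam : ℂ) * α p‖ ^ 2) : ℂ) := by fun_prop
  exact h.inv₀ fun p => by exact_mod_cast (sqrt_one_sub_norm_sq_pos ha p).ne'

/-- The coefficient of `√z` in the Szegő cocycle matrix. -/
def szegoPos (α : Torus2 → ℂ) (lam : ℝ) (p : Torus2) : Matrix (Fin 2) (Fin 2) ℂ :=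
  ((Real.sqrt (1 - ‖(lam : ℂ) * α p‖ ^ 2) : ℂ))⁻¹ • !![1, 0; -((lam : ℂ) * α p), 0]

/-- The coefficient of `1/√z` in the Szegő cocycle matrix. -/
def szegoNeg (α : Torus2 → ℂ) (lam : ℝ) (p : Torus2) : Matrix (Fin 2) (Fin 2) ℂ :=
  ((Real.sqrt (1 - ‖(lam : ℂ) * α p‖ ^ 2) : ℂ))⁻¹ • !![0, -(starRingEnd ℂ) ((lam : ℂ) * α p); 0, 1]

lemma szegoCocycle_eq (s : ℂ) (p : Torus2) :
    szegoCocycle α lam s p = s • szegoPos α lam p + s⁻¹ • szegoNeg α lam p := by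
  ext i j
  fin_cases i <;> fin_cases j <;> simp [szegoCocycle, szegoPos, szegoNeg] <;> ring

lemma continuous_szegoPos (hc : Continuous α) (ha : ∀ p, ‖(lam : ℂ) * α p‖ < 1) :
    Continuous (szegoPos α lam) := by
  refine Continuous.smul (continuous_inv_sqrt_one_sub_norm_sq hc ha)
    (continuous_matrix fun i j => ?_)
  fin_cases i <;> fin_cases j <;> simp <;> fun_prop

lemma continuous_szegoNeg (hc : Continuous α) (ha : ∀ p, ‖(lam : ℂ) * α p‖ < 1) :
    Continuous (szegoNeg α lam) := by
  refine Continuous.smul (continuous_inv_sqrt_one_sub_norm_sq hc ha)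
    (continuous_matrix fun i j => ?_)
  fin_cases i <;> fin_cases j <;> simp <;> fun_prop

lemma continuous_szegoCocycle (hc : Continuous α) (ha : ∀ p, ‖(lam : ℂ) * α p‖ < 1)
    {X : Type*} [TopologicalSpace X] {f : X → Torus2} {g : X → Circle} (hf : Continuous f)
    (hg : Continuous g) : Continuous fun x => szegoCocycle α lam (g x) (f x) := by
  have h1 := (continuous_szegoPos hc ha).comp hf
  have h2 := (continuous_szegoNeg hc ha).comp hf
  simp only [szegoCocycle_eq, ← Circle.coe_inv]
  have h3 : Continuous fun x => ((g x : Circle) : ℂ) := by fun_prop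
  have h4 : Continuous fun x => (((g x)⁻¹ : Circle) : ℂ) := by fun_prop
  exact (h3.smul h1).add (h4.smul h2)

lemma exists_szegoCocycle_bound (hc : Continuous α) (ha : ∀ p, ‖(lam : ℂ) * α p‖ < 1) :
    ∃ K : ℝ, 1 ≤ K ∧ ∀ p (s s' : Circle), ‖szegoCocycle α lam s p‖ ≤ K ∧
      ‖szegoCocycle α lam s p - szegoCocycle α lam s' p‖ ≤ K * ‖(s : ℂ) - s'‖ := by
  obtain ⟨K₁, hK₁⟩ := isCompact_univ.exists_bound_of_continuousOn
    (continuous_szegoPos hc ha).continuousOn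
  obtain ⟨K₂, hK₂⟩ := isCompact_univ.exists_bound_of_continuousOn
    (continuous_szegoNeg hc ha).continuousOn
  have h₁ := fun p => hK₁ p (Set.mem_univ p)
  have h₂ := fun p => hK₂ p (Set.mem_univ p)
  have hpos₁ := (norm_nonneg _).trans (h₁ 0)
  have hpos₂ := (norm_nonneg _).trans (h₂ 0)
  refine ⟨1 + K₁ + K₂, by linarith, fun p s s' => ⟨?_, ?_⟩⟩
  · rw [szegoCocycle_eq]
    refine (norm_add_le _ _).trans ?_
    simp only [norm_smul, norm_inv, Circle.norm_coe, inv_one, one_mul]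
    linarith [h₁ p, h₂ p]
  · have hinv : ‖(s : ℂ)⁻¹ - (s' : ℂ)⁻¹‖ = ‖(s : ℂ) - s'‖ := by
      rw [inv_sub_inv s.coe_ne_zero s'.coe_ne_zero]
      rw [norm_div, norm_mul, Circle.norm_coe, Circle.norm_coe, mul_one, div_one, norm_sub_rev]
    have heq : szegoCocycle α lam s p - szegoCocycle α lam s' p =
        ((s : ℂ) - s') • szegoPos α lam p + ((s : ℂ)⁻¹ - (s' : ℂ)⁻¹) • szegoNeg α lam p := by
      rw [szegoCocycle_eq, szegoCocycle_eq, sub_smul, sub_smul]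
      abel
    rw [heq]
    refine (norm_add_le _ _).trans ?_
    rw [norm_smul, norm_smul, hinv]
    nlinarith [h₁ p, h₂ p, norm_nonneg ((s : ℂ) - s')]

lemma norm_transfer_le {K : ℝ} (hK : 1 ≤ K)
    (hbound : ∀ p (s : Circle), ‖szegoCocycle α lam s p‖ ≤ K) (ω : Torus) (s : Circle) (n : ℕ)
    (p : Torus2) : ‖transfer α lam ω s n p‖ ≤ K ^ n := by
  induction n with
  | zero => simp [transfer]
  | succ n ih =>
    rw [transfer, pow_succ']
    exact (norm_mul_le _ _).trans
      (mul_le_mul (hbound _ _) ih (norm_nonneg _) (by linarith))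

lemma norm_transfer_sub_le {K : ℝ} (hK : 1 ≤ K)
    (hbound : ∀ p (s s' : Circle), ‖szegoCocycle α lam s p‖ ≤ K ∧
      ‖szegoCocycle α lam s p - szegoCocycle α lam s' p‖ ≤ K * ‖(s : ℂ) - s'‖)
    (ω : Torus) (s s' : Circle) (n : ℕ) (p : Torus2) :
    ‖transfer α lam ω s n p - transfer α lam ω s' n p‖ ≤ n * (K ^ n * ‖(s : ℂ) - s'‖) := by
  induction n with
  | zero => simp [transfer]
  | succ n ih =>
    have h1 := (hbound ((skewShift ω)^[n] p) s s').2
    have h2 := (hbound ((skewShift ω)^[n] p) s' s).1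
    have h3 := norm_transfer_le hK (fun p s => (hbound p s s).1) ω s n p
    have heq : transfer α lam ω s (n + 1) p - transfer α lam ω s' (n + 1) p =
        (szegoCocycle α lam s ((skewShift ω)^[n] p) -
          szegoCocycle α lam s' ((skewShift ω)^[n] p)) * transfer α lam ω s n p +
        szegoCocycle α lam s' ((skewShift ω)^[n] p) *
          (transfer α lam ω s n p - transfer α lam ω s' n p) := by
      simp only [transfer]
      noncomm_ring
    rw [heq]
    calc _ ≤ K * ‖(s : ℂ) - s'‖ * K ^ n + K * (n * (K ^ n * ‖(s : ℂ) - s'‖)) := by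
          refine (norm_add_le _ _).trans (add_le_add ?_ ?_)
          · exact (norm_mul_le _ _).trans (mul_le_mul h1 h3 (norm_nonneg _) (by positivity))
          · exact (norm_mul_le _ _).trans (mul_le_mul h2 ih (norm_nonneg _) (by positivity))
      _ = _ := by push_cast; ring

/-- The signature matrix preserved by the Szegő cocycle. -/
def szegoSignature : Matrix (Fin 2) (Fin 2) ℂ := !![1, 0; 0, -1]

lemma szegoCocycle_signature (ha : ∀ p, ‖(lam : ℂ) * α p‖ < 1) (s : Circle) (p : Torus2) :
    (szegoCocycle α lam s p)ᴴ * szegoSignature * szegoCocycle α lam s p = szegoSignature := by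
  have hρ := sqrt_one_sub_norm_sq_pos ha p
  have hρ2 : ((Real.sqrt (1 - ‖(lam : ℂ) * α p‖ ^ 2) : ℂ)) ^ 2 =
      1 - ((lam : ℂ) * α p) * (starRingEnd ℂ) ((lam : ℂ) * α p) := by
    rw [Complex.mul_conj, Complex.normSq_eq_norm_sq, ← Complex.ofReal_pow,
      Real.sq_sqrt (by nlinarith [ha p, norm_nonneg ((lam : ℂ) * α p)])]
    push_cast
    rfl
  have hs : (starRingEnd ℂ) (s : ℂ) = (s : ℂ)⁻¹ := by
    rw [← Circle.coe_inv, Circle.coe_inv_eq_conj]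
  have hs0 := s.coe_ne_zero
  unfold szegoCocycle
  generalize (lam : ℂ) * α p = a at *
  generalize Real.sqrt (1 - ‖a‖ ^ 2) = r at *
  have hr : (r : ℂ) ≠ 0 := by exact_mod_cast hρ.ne'
  ext i j
  fin_cases i <;> fin_cases j <;>
    simp [szegoSignature, Matrix.mul_apply, Fin.sum_univ_two, hs] <;> field_simp <;>
    first | ring1 | linear_combination hρ2 | linear_combination -hρ2

lemma one_le_norm_transfer (ha : ∀ p, ‖(lam : ℂ) * α p‖ < 1) (ω : Torus) (s : Circle) (n : ℕ)
    (p : Torus2) : 1 ≤ ‖transfer α lam ω s n p‖ := by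
  have hJ : (transfer α lam ω s n p)ᴴ * szegoSignature * transfer α lam ω s n p =
      szegoSignature := by
    induction n with
    | zero => simp [transfer]
    | succ n ih =>
      rw [transfer, Matrix.conjTranspose_mul]
      calc _ = (transfer α lam ω s n p)ᴴ * ((szegoCocycle α lam s ((skewShift ω)^[n] p))ᴴ *
            szegoSignature * szegoCocycle α lam s ((skewShift ω)^[n] p)) *
            transfer α lam ω s n p := by simp only [Matrix.mul_assoc]
        _ = _ := by rw [szegoCocycle_signature ha, ih]
  have hpos : 0 < ‖szegoSignature‖ := by
    rw [norm_pos_iff]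
    intro h
    simpa [szegoSignature] using congrFun (congrFun h 0) 0
  have h := (norm_mul_le _ _).trans (mul_le_mul_of_nonneg_right (norm_mul_le
    (transfer α lam ω s n p)ᴴ szegoSignature) (norm_nonneg (transfer α lam ω s n p)))
  rw [hJ, Matrix.l2_opNorm_conjTranspose] at h
  by_contra! hlt
  nlinarith [norm_nonneg (transfer α lam ω s n p), mul_pos hpos (sub_pos.2 hlt)]

lemma continuous_transfer_s12 (hc : Continuous α) (ha : ∀ p, ‖(lam : ℂ) * α p‖ < 1) (n : ℕ)
    {X : Type*} [TopologicalSpace X] {f : X → Torus} {g : X → Circle} {h : X → Torus2}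
    (hf : Continuous f) (hg : Continuous g) (hh : Continuous h) :
    Continuous fun x => transfer α lam (f x) (g x) n (h x) := by
  have hiter : ∀ n : ℕ, Continuous fun x => (skewShift (f x))^[n] (h x) := by
    intro n
    induction n with
    | zero => exact hh
    | succ n ih =>
      simp only [Function.iterate_succ_apply', skewShift]
      fun_prop
  induction n with
  | zero => exact continuous_const
  | succ n ih => exact (continuous_szegoCocycle hc ha (hiter n) hg).mul ih

lemma continuous_log_matOpNorm_transfer (hc : Continuous α) (ha : ∀ p, ‖(lam : ℂ) * α p‖ < 1)
    (n : ℕ) {X : Type*} [TopologicalSpace X] {f : X → Torus} {g : X → Circle} {h : X → Torus2}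
    (hf : Continuous f) (hg : Continuous g) (hh : Continuous h) :
    Continuous fun x => Real.log (matOpNorm (transfer α lam (f x) (g x) n (h x))) :=
  Continuous.log (continuous_transfer_s12 hc ha n hf hg hh).norm fun x =>
    (zero_lt_one.trans_le (one_le_norm_transfer ha (f x) (g x) n (h x))).ne'

lemma log_matOpNorm_transfer_sub_le {K : ℝ} (hK : 1 ≤ K) (ha : ∀ p, ‖(lam : ℂ) * α p‖ < 1)
    (hbound : ∀ p (s s' : Circle), ‖szegoCocycle α lam s p‖ ≤ K ∧
      ‖szegoCocycle α lam s p - szegoCocycle α lam s' p‖ ≤ K * ‖(s : ℂ) - s'‖)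
    (ω : Torus) (s s' : Circle) (n : ℕ) (p : Torus2) :
    Real.log (matOpNorm (transfer α lam ω s n p)) -
      Real.log (matOpNorm (transfer α lam ω s' n p)) ≤ n * (K ^ n * ‖(s : ℂ) - s'‖) := by
  have h1 := one_le_norm_transfer ha ω s n p
  have h2 := one_le_norm_transfer ha ω s' n p
  have h3 := norm_transfer_sub_le hK hbound ω s s' n p
  change Real.log ‖transfer α lam ω s n p‖ - Real.log ‖transfer α lam ω s' n p‖ ≤ _
  rw [← Real.log_div (by linarith) (by linarith)]
  refine (Real.log_le_sub_one_of_pos (by positivity)).trans (le_trans ?_ h3)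
  rw [div_sub_one (by linarith)]
  have h4 := norm_sub_norm_le (transfer α lam ω s n p) (transfer α lam ω s' n p)
  exact (div_le_of_le_mul₀ (by linarith) (norm_nonneg _)
    (h4.trans (le_mul_of_one_le_right (norm_nonneg _) h2)))

end Transfer

instance : IsProbabilityMeasure (volume : Measure Torus) := ⟨by simp⟩

lemma continuous_LyapFin {α : Torus2 → ℂ} {lam : ℝ} (hc : Continuous α)
    (ha : ∀ p, ‖(lam : ℂ) * α p‖ < 1) (n : ℕ) {X : Type*} [TopologicalSpace X]
    [FirstCountableTopology X] [LocallyCompactSpace X] {f : X → Torus} {g : X → Circle}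
    (hf : Continuous f) (hg : Continuous g) :
    Continuous fun x => LyapFin α lam (f x) (g x) n := by
  have h := continuous_parametric_integral_of_continuous (μ := (volume : Measure Torus2))
    (f := fun x p => Real.log (matOpNorm (transfer α lam (f x) (g x) n p)))
    (continuous_log_matOpNorm_transfer hc ha n (hf.comp continuous_fst) (hg.comp continuous_fst)
      continuous_snd) isCompact_univ
  simp only [Measure.restrict_univ] at h
  exact continuous_const.mul h

lemma LyapFin_sub_le {α : Torus2 → ℂ} {lam : ℝ} (hc : Continuous α)
    (ha : ∀ p, ‖(lam : ℂ) * α p‖ < 1) {n : ℕ} (hn : 0 < n) {ω : Torus} {s s' : Circle} {δ : ℝ}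
    (h : ∀ p, Real.log (matOpNorm (transfer α lam ω s n p)) -
      Real.log (matOpNorm (transfer α lam ω s' n p)) ≤ n * δ) :
    LyapFin α lam ω s n - LyapFin α lam ω s' n ≤ δ := by
  have hint : ∀ s : Circle, Integrable fun p : Torus2 =>
      Real.log (matOpNorm (transfer α lam ω s n p)) := fun s =>
    (continuous_log_matOpNorm_transfer hc ha n continuous_const continuous_const
      continuous_id).integrable_of_hasCompactSupport
      (HasCompactSupport.of_compactSpace _)
  have hn' : (0 : ℝ) < n := by exact_mod_cast hn
  rw [LyapFin, LyapFin, ← mul_sub, ← integral_sub (hint s) (hint s'), inv_mul_le_iff₀ hn']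
  refine (integral_mono ((hint s).sub (hint s')) (integrable_const _) h).trans ?_
  simp

/-! ### Resonant parameters -/

lemma exists_circle_sq_eq {z : ℂ} (hz : ‖z‖ = 1) : ∃ s : Circle, (s : ℂ) ^ 2 = z := by
  obtain ⟨t, ht⟩ := IsAlgClosed.exists_pow_nat_eq z (n := 2) two_pos
  have hnorm : ‖t‖ = 1 := by
    have h : ‖t‖ ^ 2 = 1 := by rw [← norm_pow, ht, hz]
    exact (pow_eq_one_iff_of_nonneg (norm_nonneg t) two_ne_zero).1 h
  exact ⟨⟨t, mem_sphere_zero_iff_norm.2 hnorm⟩, ht⟩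

lemma exists_circle_sq_eq_near {w : ℂ} (hw : ‖w‖ = 1) (s : Circle) :
    ∃ s' : Circle, (s' : ℂ) ^ 2 = w ∧ ‖(s : ℂ) - s'‖ ≤ ‖(s : ℂ) ^ 2 - w‖ := by
  obtain ⟨t, rfl⟩ := exists_circle_sq_eq hw
  have hprod : ‖(s : ℂ) ^ 2 - (t : ℂ) ^ 2‖ = ‖(s : ℂ) + t‖ * ‖(s : ℂ) - t‖ := by
    rw [← norm_mul, sq_sub_sq]
  have hpar := parallelogram_law_with_norm ℝ (s : ℂ) t
  rw [Circle.norm_coe, Circle.norm_coe] at hpar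
  have hp := norm_nonneg ((s : ℂ) + t)
  have hm := norm_nonneg ((s : ℂ) - t)
  by_cases h : 1 ≤ ‖(s : ℂ) + t‖
  · exact ⟨t, rfl, by nlinarith⟩
  · refine ⟨-t, by simp, ?_⟩
    rw [hprod, Circle.coe_neg, sub_neg_eq_add]
    have h' : 1 ≤ ‖(s : ℂ) - t‖ := by nlinarith
    nlinarith

lemma continuous_finCMV_E {X : Type*} [TopologicalSpace X] {c : X → ℤ → ℂ}
    (hc : ∀ n, Continuous fun x => c x n) (a b : ℤ) (β γ : ℂ) :
    Continuous fun x => finCMV_E a b β γ (c x) := by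
  have hmod : ∀ n, Continuous fun x => modCoeff a b β γ (c x) n := by
    intro n
    unfold modCoeff
    split_ifs <;> fun_prop
  have hrho : ∀ n, Continuous fun x => (rhoSeq (modCoeff a b β γ (c x)) n : ℂ) := by
    intro n
    unfold rhoSeq
    have := hmod n
    fun_prop
  have hstar : ∀ n, Continuous fun x => (starRingEnd ℂ) (modCoeff a b β γ (c x) n) :=
    fun n => Complex.continuous_conj.comp (hmod n)
  have hL : Continuous fun x => finCMV_L a b β γ (c x) := by
    refine continuous_matrix fun i j => ?_
    unfold finCMV_L cmvL
    split_ifs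
    exacts [hstar _, hrho _, continuous_const, hrho _, (hmod _).neg, continuous_const]
  have hM : Continuous fun x => finCMV_M a b β γ (c x) := by
    refine continuous_matrix fun i j => ?_
    unfold finCMV_M cmvM
    split_ifs
    exacts [hstar _, hrho _, continuous_const, hrho _, (hmod _).neg, continuous_const]
  exact hL.matrix_mul hM

/-- The parameters `(ω, y₀, x, y)` for which `ω` satisfies the Diophantine condition up to scale
`N` and some eigenvalue `s²` of the finite CMV matrix on `[-N₁, N₁]` based at `(0, y₀)` produces a
deviation at `(x, y)` of at least `η`. -/
def resonantSet (ε : ℝ) (β γ : ℂ) (α : Torus2 → ℂ) (lam η : ℝ) (N N₁ : ℕ) :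
    Set (Torus × Torus × Torus2) :=
  {q | (∀ k : ℕ, 0 < k → k < N →
      ε * (k : ℝ)⁻¹ * ((1 + Real.log k) ^ 2)⁻¹ ≤ ‖(k : ℤ) • q.1‖) ∧
    ∃ s : Circle, (finCMV_E (-(N₁ : ℤ)) (N₁ : ℤ) β γ
        (skewCoeff α lam q.1 (0, q.2.1))).charpoly.eval ((s : ℂ) ^ 2) = 0 ∧
      (N : ℝ)⁻¹ * Real.log (matOpNorm (transfer α lam q.1 s N q.2.2)) ≤
        LyapFin α lam q.1 s N - η}

lemma isClosed_resonantSet {α : Torus2 → ℂ} {lam : ℝ} (hc : Continuous α)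
    (ha : ∀ p, ‖(lam : ℂ) * α p‖ < 1) (ε : ℝ) (β γ : ℂ) (η : ℝ) (N N₁ : ℕ) :
    IsClosed (resonantSet ε β γ α lam η N N₁) := by
  have hdioph : IsClosed {q : Torus × Torus × Torus2 | ∀ k : ℕ, 0 < k → k < N →
      ε * (k : ℝ)⁻¹ * ((1 + Real.log k) ^ 2)⁻¹ ≤ ‖(k : ℤ) • q.1‖} := by
    simp only [Set.ofPred_forall]
    exact isClosed_iInter fun k => isClosed_iInter fun _ => isClosed_iInter fun _ =>
      isClosed_le continuous_const ((continuous_fst.zsmul (k : ℤ)).norm)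
  have hcoeff : ∀ n, Continuous fun q : (Torus × Torus × Torus2) × Circle =>
      skewCoeff α lam q.1.1 (0, q.1.2.1) n := by
    intro n
    unfold skewCoeff skewIter
    fun_prop
  have hE := continuous_finCMV_E hcoeff (-(N₁ : ℤ)) N₁ β γ
  have hdet : Continuous fun q : (Torus × Torus × Torus2) × Circle =>
      (finCMV_E (-(N₁ : ℤ)) (N₁ : ℤ) β γ
        (skewCoeff α lam q.1.1 (0, q.1.2.1))).charpoly.eval ((q.2 : ℂ) ^ 2) := by
    simp only [Matrix.eval_charpoly]
    refine Continuous.matrix_det (Continuous.sub ?_ hE)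
    simp only [Matrix.scalar_apply]
    exact Continuous.matrix_diagonal (continuous_pi fun _ => by fun_prop)
  have hω : Continuous fun q : (Torus × Torus × Torus2) × Circle => q.1.1 := by fun_prop
  have hp : Continuous fun q : (Torus × Torus × Torus2) × Circle => q.1.2.2 := by fun_prop
  have hlog : Continuous fun q : (Torus × Torus × Torus2) × Circle =>
      (N : ℝ)⁻¹ * Real.log (matOpNorm (transfer α lam q.1.1 q.2 N q.1.2.2)) :=
    continuous_const.mul (continuous_log_matOpNorm_transfer hc ha N hω continuous_snd hp)
  have hlyap : Continuous fun q : (Torus × Torus × Torus2) × Circle =>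
      LyapFin α lam q.1.1 q.2 N - η :=
    (continuous_LyapFin hc ha N hω continuous_snd).sub continuous_const
  have hclosed := (isClosed_eq hdet (continuous_const (y := (0 : ℂ)))).inter (isClosed_le hlog hlyap)
  convert hdioph.inter (isClosedMap_fst_of_compactSpace _ hclosed) using 1
  ext q
  simp only [resonantSet, Set.mem_image, Set.mem_inter_iff, Set.mem_ofPred_eq, Prod.exists,
    exists_and_right, exists_eq_right]

/-- The number of square roots of eigenvalues of a matrix is at most twice its size, counted
through the measure of a union of events indexed by these square roots. -/
lemma measure_exists_sq_eigenvalue_le {n : Type*} [Fintype n] [DecidableEq n] (U : Matrix n n ℂ)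
    {Ω : Type*} [MeasurableSpace Ω] (μ : Measure Ω) {D : Circle → Set Ω} {δ : ENNReal}
    (hD : ∀ s, μ (D s) ≤ δ) :
    μ {p | ∃ s : Circle, U.charpoly.eval ((s : ℂ) ^ 2) = 0 ∧ p ∈ D s} ≤
      (2 * Fintype.card n : ℕ) * δ := by
  set P := Polynomial.expand ℂ 2 U.charpoly with hP
  have hP0 : P ≠ 0 := (Polynomial.expand_ne_zero two_pos).2 U.charpoly_monic.ne_zero
  have hdeg : P.natDegree = 2 * Fintype.card n := by
    rw [hP, Polynomial.natDegree_expand, Matrix.charpoly_natDegree_eq_dim, mul_comm]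
  have hsub : {p | ∃ s : Circle, U.charpoly.eval ((s : ℂ) ^ 2) = 0 ∧ p ∈ D s} ⊆
      ⋃ w ∈ P.roots.toFinset, {p | ∃ s : Circle, (s : ℂ) = w ∧ p ∈ D s} := by
    rintro p ⟨s, hs, hp⟩
    simp only [Set.mem_iUnion, Multiset.mem_toFinset]
    refine ⟨s, ?_, s, rfl, hp⟩
    rw [Polynomial.mem_roots hP0, Polynomial.IsRoot, hP, Polynomial.expand_eval, hs]
  have hfib : ∀ w : ℂ, μ {p | ∃ s : Circle, (s : ℂ) = w ∧ p ∈ D s} ≤ δ := by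
    intro w
    by_cases hw : ∃ s : Circle, (s : ℂ) = w
    · obtain ⟨s, rfl⟩ := hw
      refine (measure_mono ?_).trans (hD s)
      rintro p ⟨s', hs', hp⟩
      rwa [Circle.ext hs'] at hp
    · refine (measure_mono_null ?_ measure_empty).trans_le zero_le
      rintro p ⟨s, hs, -⟩
      exact hw ⟨s, hs⟩
  calc _ ≤ ∑ w ∈ P.roots.toFinset, μ {p | ∃ s : Circle, (s : ℂ) = w ∧ p ∈ D s} :=
        (measure_mono hsub).trans (measure_biUnion_finset_le _ _)
    _ ≤ ∑ _w ∈ P.roots.toFinset, δ := Finset.sum_le_sum fun w _ => hfib w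
    _ = P.roots.toFinset.card * δ := by rw [Finset.sum_const, nsmul_eq_mul]
    _ ≤ _ := by
      gcongr
      rw [← hdeg]
      exact (Multiset.toFinset_card_le _).trans P.card_roots'

lemma Measure.prod_apply_le_of_forall_section_le {X Y : Type*} [MeasurableSpace X]
    [MeasurableSpace Y] {μ : Measure X} [IsProbabilityMeasure μ] {ν : Measure Y} [SFinite ν]
    {A : Set (X × Y)} (hA : MeasurableSet A) {δ : ENNReal}
    (h : ∀ x, ν (Prod.mk x ⁻¹' A) ≤ δ) : μ.prod ν A ≤ δ := by
  rw [Measure.prod_apply hA]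
  exact (lintegral_mono h).trans (by simp)

lemma volume_resonantSet_le {ε : ℝ} {β γ : ℂ} {α : Torus2 → ℂ} {lam : ℝ} (hc : Continuous α)
    (ha : ∀ p, ‖(lam : ℂ) * α p‖ < 1) {η : ℝ} {N : ℕ} {δ : ENNReal}
    (hdev : ∀ ω : Torus, (∀ k : ℕ, 0 < k → k < N →
        ε * (k : ℝ)⁻¹ * ((1 + Real.log k) ^ 2)⁻¹ ≤ ‖(k : ℤ) • ω‖) → ∀ s : Circle,
      volume {p : Torus2 | (N : ℝ)⁻¹ * Real.log (matOpNorm (transfer α lam ω s N p)) ≤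
        LyapFin α lam ω s N - η} ≤ δ) (N₁ : ℕ) :
    volume (resonantSet ε β γ α lam η N N₁) ≤ (2 * (2 * N₁ + 1) : ℕ) * δ := by
  have : BorelSpace (Torus × Torus2) := inferInstance
  have : SecondCountableTopology (Torus × Torus2) := inferInstance
  have : BorelSpace (Torus × Torus × Torus2) := Prod.borelSpace
  have hmeas := (isClosed_resonantSet hc ha ε β γ η N N₁).measurableSet
  refine Measure.prod_apply_le_of_forall_section_le hmeas fun ω => ?_
  refine Measure.prod_apply_le_of_forall_section_le (measurable_prodMk_left hmeas) fun y₀ => ?_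
  by_cases hω : ∀ k : ℕ, 0 < k → k < N →
    ε * (k : ℝ)⁻¹ * ((1 + Real.log k) ^ 2)⁻¹ ≤ ‖(k : ℤ) • ω‖
  · have h := measure_exists_sq_eigenvalue_le (finCMV_E (-(N₁ : ℤ)) (N₁ : ℤ) β γ
      (skewCoeff α lam ω (0, y₀))) volume (hdev ω hω)
    have hcard : Fintype.card (Set.Icc (-(N₁ : ℤ)) (N₁ : ℤ)) = 2 * N₁ + 1 := by
      rw [Fintype.card_ofFinset, Int.card_Icc]
      omega
    rw [hcard] at h
    refine (measure_mono ?_).trans h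
    rintro p ⟨-, hp⟩
    exact hp
  · refine (measure_mono_null ?_ measure_empty).trans_le zero_le
    rintro p ⟨hp, -⟩
    exact hω hp

lemma exists_rpow_sq_mul_exp_neg_le (C₁ : ℝ) {σ : ℝ} (hσ : 0 < σ) :
    ∃ B : ℝ, ∀ N : ℕ, ((N : ℝ) ^ C₁) ^ 2 * Real.exp (-(N : ℝ) ^ σ / 2) ≤ B := by
  have h1 := tendsto_rpow_mul_exp_neg_mul_atTop_nhds_zero (2 * C₁ / σ) (1 / 2) (by norm_num)
  have h2 := h1.comp ((tendsto_rpow_atTop hσ).comp tendsto_natCast_atTop_atTop)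
  obtain ⟨B, hB⟩ := h2.bddAbove_range
  refine ⟨B, fun N => le_trans (le_of_eq ?_) (hB ⟨N, rfl⟩)⟩
  simp only [Function.comp_apply]
  rw [← Real.rpow_mul (Nat.cast_nonneg N), ← Real.rpow_mul_natCast (Nat.cast_nonneg N)]
  congr 2
  · push_cast
    field_simp
  · ring

lemma pow_mul_le_of_log_le {K c C d : ℝ} (hK : 1 ≤ K) (hc : 0 < c)
    (hC : Real.log (K * max 1 (60 / c)) ≤ C) {N : ℕ} (hN : 0 < N)
    (hd : d ≤ (Real.exp (C * N))⁻¹) : K ^ N * d ≤ c / 60 := by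
  have hM : (1 : ℝ) ≤ max 1 (60 / c) := le_max_left _ _
  have hKM : 0 < K * max 1 (60 / c) := by positivity
  rw [Real.log_le_iff_le_exp hKM] at hC
  have hexp : (Real.exp (C * N))⁻¹ ≤ ((K * max 1 (60 / c)) ^ N)⁻¹ := by
    rw [mul_comm, Real.exp_nat_mul]
    gcongr
  calc K ^ N * d ≤ K ^ N * ((K * max 1 (60 / c)) ^ N)⁻¹ := by
        gcongr
        exact hd.trans hexp
    _ = (max 1 (60 / c) ^ N)⁻¹ := by
        rw [mul_pow]
        field_simp
    _ ≤ (60 / c)⁻¹ := by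
        gcongr
        exact (le_max_right _ _).trans (le_self_pow₀ hM hN.ne')
    _ = c / 60 := inv_div _ _

open scoped Matrix.Norms.L2Operator in
/-- Every parameter in the projected double resonance set is resonant: condition (ii) yields an
eigenvalue `w` close to `z`, and the deviation at `z` persists at `w` with a smaller threshold. -/
lemma image_subset_iUnion_resonantSet {ε C₁ : ℝ} {β γ : ℂ} {α : Torus2 → ℂ} {lam : ℝ}
    (hc : Continuous α) (ha : ∀ p, ‖(lam : ℂ) * α p‖ < 1) (hβ : ‖β‖ = 1) (hγ : ‖γ‖ = 1)
    {c₀ : ℝ} (hc₀ : 0 < c₀) {K : ℝ} (hK : 1 ≤ K)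
    (hbound : ∀ (p : Torus2) (s s' : Circle), ‖szegoCocycle α lam s p‖ ≤ K ∧
      ‖szegoCocycle α lam s p - szegoCocycle α lam s' p‖ ≤ K * ‖(s : ℂ) - s'‖)
    {C₂ : ℝ} (hC₂ : Real.log (K * max 1 (60 / c₀)) ≤ C₂) {N : ℕ} (hN : 0 < N) :
    ((fun q : Torus × Torus × Torus × Torus × ℂ => (q.1, q.2.1, q.2.2.1, q.2.2.2.1)) ''
          {q : Torus × Torus × Torus × Torus × ℂ |
            ‖q.2.2.2.2‖ = 1 ∧
            ∃ N₁ : ℕ, (N₁ : ℝ) < (N : ℝ) ^ C₁ ∧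
              (∀ k : ℕ, 0 < k → k < N →
                ε * (k : ℝ)⁻¹ * ((1 + Real.log k) ^ 2)⁻¹ ≤ ‖(k : ℤ) • q.1‖) ∧
              Real.exp (C₂ * N) <
                matOpNorm ((finCMV_E (-(N₁ : ℤ)) (N₁ : ℤ) β γ
                    (skewCoeff α lam q.1 (0, q.2.1)) - q.2.2.2.2 • 1)⁻¹) ∧
              ∀ sz : ℂ, sz ^ 2 = q.2.2.2.2 →
                (N : ℝ)⁻¹ * Real.log
                    (matOpNorm (transfer α lam q.1 sz N (q.2.2.1, q.2.2.2.1))) <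
                  LyapFin α lam q.1 sz N - c₀ / 10}) ⊆
      ⋃ N₁ ∈ Finset.range ⌈(N : ℝ) ^ C₁⌉₊, resonantSet ε β γ α lam (c₀ / 15) N N₁ := by
  rintro _ ⟨⟨ω, y₀, x, y, z⟩, ⟨hz, N₁, hN₁, hω, hres, hdev⟩, rfl⟩
  dsimp only at hz hω hres hdev
  simp only [Set.mem_iUnion]
  refine ⟨N₁, Finset.mem_range.2 (Nat.lt_ceil.2 hN₁), hω, ?_⟩
  obtain ⟨s, rfl⟩ := exists_circle_sq_eq hz
  have : Nonempty (Set.Icc (-(N₁ : ℤ)) (N₁ : ℤ)) := ⟨⟨0, by simp⟩⟩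
  obtain ⟨w, hw, hspec, hnear⟩ := exists_eigenvalue_near_of_lt_norm_inv
    (finCMV_E_mem_unitaryGroup (by omega) hβ hγ fun n => (ha (skewIter ω n (0, y₀))).le)
    (Real.exp_pos _) hres
  obtain ⟨s', rfl, hs'⟩ := exists_circle_sq_eq_near hw s
  refine ⟨s', Matrix.mem_spectrum_iff_isRoot_charpoly.1 hspec, ?_⟩
  have hsmall : K ^ N * ‖(s : ℂ) - s'‖ ≤ c₀ / 60 :=
    pow_mul_le_of_log_le hK hc₀ hC₂ hN (hs'.trans hnear)
  have hupper : ∀ p, Real.log (matOpNorm (transfer α lam ω s' N p)) -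
      Real.log (matOpNorm (transfer α lam ω s N p)) ≤ N * (c₀ / 60) := fun p =>
    (log_matOpNorm_transfer_sub_le hK ha hbound ω s' s N p).trans (by rw [norm_sub_rev]; gcongr)
  have hlower : ∀ p, Real.log (matOpNorm (transfer α lam ω s N p)) -
      Real.log (matOpNorm (transfer α lam ω s' N p)) ≤ N * (c₀ / 60) := fun p =>
    (log_matOpNorm_transfer_sub_le hK ha hbound ω s s' N p).trans (by gcongr)
  have hL := LyapFin_sub_le hc ha hN hlower
  have hN' : (0 : ℝ) < N := by exact_mod_cast hN
  have hT : (N : ℝ)⁻¹ * Real.log (matOpNorm (transfer α lam ω s' N (x, y))) -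
      (N : ℝ)⁻¹ * Real.log (matOpNorm (transfer α lam ω s N (x, y))) ≤ c₀ / 60 := by
    rw [← mul_sub, inv_mul_le_iff₀ hN']
    exact hupper (x, y)
  have := hdev s rfl
  dsimp only
  linarith

/-- **Lemma 4.6** (elimination of double resonances, measure estimate). Fix `ε > 0` small,
unimodular `β, γ`, `C₁ ≥ 1`, `c₀ > 0`, a nonconstant trigonometric polynomial
`α : 𝕋² → 𝔻` and `λ ∈ (0,1)`. Assume `inf_{z ∈ ∂𝔻} L(z) > c₀` and the large deviation
estimate at scale `N` with exponent `σ`. Then for all sufficiently large `C₂` there is a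
constant `C` such that for every `N ≥ 1`, the projection to `𝕋⁴` of the set `S_N` of
`(ω, y₀, x, y, z)` (with `z ∈ ∂𝔻`) for which some `N₁ < N^{C₁}` realizes the Diophantine
condition (i), the resonance condition (ii) at `(0,y₀)`, and the deviation condition (iii)
at `(x,y)`, has measure at most `C·e^{−N^σ/2}`. -/
theorem elimination_double_resonances :
    ∀ ε : ℝ, 0 < ε → ∀ β γ : ℂ, ‖β‖ = 1 → ‖γ‖ = 1 →
    ∀ C₁ : ℝ, 1 ≤ C₁ → ∀ c₀ : ℝ, 0 < c₀ →
    ∀ α : Torus2 → ℂ, (∀ p, ‖α p‖ < 1) → IsTrigPoly α → (∃ p q, α p ≠ α q) →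
    ∀ lam : ℝ, 0 < lam → lam < 1 →
    (∀ (ω : Torus) (z sz : ℂ), ‖z‖ = 1 → sz ^ 2 = z →
      ∃ L : ℝ, Tendsto (fun n => LyapFin α lam ω sz n) atTop (nhds L) ∧ c₀ < L) →
    ∀ σ : ℝ, 0 < σ →
    (∀ N : ℕ, 0 < N → ∀ ω : Torus,
      (∀ k : ℕ, 0 < k → k < N →
        ε * (k : ℝ)⁻¹ * ((1 + Real.log k) ^ 2)⁻¹ ≤ ‖(k : ℤ) • ω‖) →
      ∀ z sz : ℂ, ‖z‖ = 1 → sz ^ 2 = z →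
        volume {p : Torus2 |
            |(N : ℝ)⁻¹ * Real.log (matOpNorm (transfer α lam ω sz N p)) -
              LyapFin α lam ω sz N| > c₀ / 20}
          ≤ ENNReal.ofReal (Real.exp (-(N : ℝ) ^ σ))) →
    ∃ C₂₀ : ℝ, ∀ C₂ : ℝ, C₂₀ ≤ C₂ → ∃ C > (0:ℝ), ∀ N : ℕ, 0 < N →
      volume
        ((fun q : Torus × Torus × Torus × Torus × ℂ => (q.1, q.2.1, q.2.2.1, q.2.2.2.1)) ''
          {q : Torus × Torus × Torus × Torus × ℂ |
            ‖q.2.2.2.2‖ = 1 ∧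
            ∃ N₁ : ℕ, (N₁ : ℝ) < (N : ℝ) ^ C₁ ∧
              (∀ k : ℕ, 0 < k → k < N →
                ε * (k : ℝ)⁻¹ * ((1 + Real.log k) ^ 2)⁻¹ ≤ ‖(k : ℤ) • q.1‖) ∧
              Real.exp (C₂ * N) <
                matOpNorm ((finCMV_E (-(N₁ : ℤ)) (N₁ : ℤ) β γ
                    (skewCoeff α lam q.1 (0, q.2.1)) - q.2.2.2.2 • 1)⁻¹) ∧
              ∀ sz : ℂ, sz ^ 2 = q.2.2.2.2 →
                (N : ℝ)⁻¹ * Real.log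
                    (matOpNorm (transfer α lam q.1 sz N (q.2.2.1, q.2.2.2.1))) <
                  LyapFin α lam q.1 sz N - c₀ / 10})
        ≤ ENNReal.ofReal (C * Real.exp (-(N : ℝ) ^ σ / 2)) := by
  intro ε _ β γ hβ hγ C₁ hC₁ c₀ hc₀ α hα htrig _ lam hlam0 hlam1 _ σ hσ hLDT
  have hc := htrig.continuous
  have ha := norm_smul_coeff_lt hα hlam0 hlam1
  obtain ⟨K, hK, hbound⟩ := exists_szegoCocycle_bound hc ha
  obtain ⟨B, hB⟩ := exists_rpow_sq_mul_exp_neg_le C₁ hσ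
  refine ⟨Real.log (K * max 1 (60 / c₀)), fun C₂ hC₂ => ⟨12 * max B 1, by positivity, ?_⟩⟩
  intro N hN
  have hsubset := image_subset_iUnion_resonantSet (ε := ε) (C₁ := C₁) hc ha hβ hγ hc₀ hK hbound
    hC₂ hN
  refine (measure_mono hsubset).trans ?_
  have hdev : ∀ ω : Torus, (∀ k : ℕ, 0 < k → k < N →
      ε * (k : ℝ)⁻¹ * ((1 + Real.log k) ^ 2)⁻¹ ≤ ‖(k : ℤ) • ω‖) → ∀ s : Circle,
      volume {p : Torus2 | (N : ℝ)⁻¹ * Real.log (matOpNorm (transfer α lam ω s N p)) ≤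
        LyapFin α lam ω s N - c₀ / 15} ≤ ENNReal.ofReal (Real.exp (-(N : ℝ) ^ σ)) := by
    intro ω hω s
    refine (measure_mono fun p hp => ?_).trans
      (hLDT N hN ω hω ((s : ℂ) ^ 2) s (by rw [norm_pow, Circle.norm_coe, one_pow]) rfl)
    rw [Set.mem_ofPred_eq] at hp ⊢
    rw [gt_iff_lt, lt_abs]
    right
    linarith
  calc _ ≤ ∑ N₁ ∈ Finset.range ⌈(N : ℝ) ^ C₁⌉₊,
          volume (resonantSet ε β γ α lam (c₀ / 15) N N₁) := measure_biUnion_finset_le _ _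
    _ ≤ ∑ N₁ ∈ Finset.range ⌈(N : ℝ) ^ C₁⌉₊,
          (2 * (2 * N₁ + 1) : ℕ) * ENNReal.ofReal (Real.exp (-(N : ℝ) ^ σ)) :=
        Finset.sum_le_sum fun N₁ _ => volume_resonantSet_le hc ha hdev N₁
    _ ≤ ∑ _N₁ ∈ Finset.range ⌈(N : ℝ) ^ C₁⌉₊,
          ENNReal.ofReal (6 * (N : ℝ) ^ C₁ * Real.exp (-(N : ℝ) ^ σ)) := by
        refine Finset.sum_le_sum fun N₁ hN₁ => ?_
        have hlt := Nat.lt_ceil.1 (Finset.mem_range.1 hN₁)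
        rw [← ENNReal.ofReal_natCast, ← ENNReal.ofReal_mul (Nat.cast_nonneg _)]
        refine ENNReal.ofReal_le_ofReal (mul_le_mul_of_nonneg_right ?_ (Real.exp_pos _).le)
        have h1 : (1 : ℝ) ≤ (N : ℝ) ^ C₁ :=
          Real.one_le_rpow (by exact_mod_cast hN) (by linarith)
        push_cast
        linarith
    _ = ENNReal.ofReal (⌈(N : ℝ) ^ C₁⌉₊ * (6 * (N : ℝ) ^ C₁ * Real.exp (-(N : ℝ) ^ σ))) := by
        rw [Finset.sum_const, Finset.card_range, nsmul_eq_mul,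
          ENNReal.ofReal_mul (Nat.cast_nonneg _), ENNReal.ofReal_natCast]
    _ ≤ _ := ENNReal.ofReal_le_ofReal ?_
  have h1 : (1 : ℝ) ≤ (N : ℝ) ^ C₁ := Real.one_le_rpow (by exact_mod_cast hN) (by linarith)
  have hceil : (⌈(N : ℝ) ^ C₁⌉₊ : ℝ) ≤ 2 * (N : ℝ) ^ C₁ := by
    linarith [Nat.ceil_lt_add_one (zero_le_one.trans h1)]
  have hexp : Real.exp (-(N : ℝ) ^ σ) =
      Real.exp (-(N : ℝ) ^ σ / 2) * Real.exp (-(N : ℝ) ^ σ / 2) := by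
    rw [← Real.exp_add, add_halves]
  calc _ ≤ 2 * (N : ℝ) ^ C₁ * (6 * (N : ℝ) ^ C₁ * Real.exp (-(N : ℝ) ^ σ)) := by gcongr
    _ = 12 * (((N : ℝ) ^ C₁) ^ 2 * Real.exp (-(N : ℝ) ^ σ / 2)) *
          Real.exp (-(N : ℝ) ^ σ / 2) := by rw [hexp]; ring
    _ ≤ _ := by
        gcongr
        exact (hB N).trans (le_max_left _ _)
end
end
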